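/- arXiv:1706.03670 — 4 statements merged into one kernel-verified Lean document; each statement's English description precedes it below -/
import Mathlib

section
/- Let BH^{≤d}_{[-1,1]} denote the smallest constant C ≥ 1 such that for every n ∈ ℕ and every real polynomial P(x) = ∑_{α ∈ ℕ₀^n, |α| ≤ d} a_α x^α of degree at most d one has (∑_{|α| ≤ d} |a_α|^{2d/(d+1)})^{(d+1)/(2d)} ≤ C · sup_{x ∈ [-1,1]^n} |P(x)|. Then limsup_{d → ∞} (BH^{≤d}_{[-1,1]})^{1/d} = 1 + √2. -/
open Finset

/-- The sup norm of a real polynomial in `n` variables over the cube `[-1,1]^n`. -/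
noncomputable def supOnBox {n : ℕ} (P : MvPolynomial (Fin n) ℝ) : ℝ :=
  sSup {y : ℝ | ∃ x : Fin n → ℝ, (∀ i, x i ∈ Set.Icc (-1 : ℝ) 1) ∧
    y = |MvPolynomial.eval x P|}

/-- `C` is an admissible Bohnenblust–Hille constant for real polynomials of degree at most `d`
on `[-1,1]^n` (for all `n`). -/
def IsDegBHConst (d : ℕ) (C : ℝ) : Prop :=
  1 ≤ C ∧ ∀ (n : ℕ) (P : MvPolynomial (Fin n) ℝ), P.totalDegree ≤ d →
    (∑ α ∈ P.support, |P.coeff α| ^ ((2 * d : ℝ) / (d + 1))) ^ ((d + 1 : ℝ) / (2 * d))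
      ≤ C * supOnBox P

open scoped BigOperators

/-- The point of the torus whose coordinates are the `N`-th roots of unity indexed by `x`. -/
noncomputable def rootPoint {σ : Type*} {N : ℕ} [NeZero N] (x : σ → ZMod N) (v : σ) : ℂ :=
  ZMod.stdAddChar (x v)

lemma norm_stdAddChar {N : ℕ} [NeZero N] (j : ZMod N) : ‖(ZMod.stdAddChar j : ℂ)‖ = 1 := by
  exact AddChar.norm_apply _ _

lemma norm_rootPoint {σ : Type*} {N : ℕ} [NeZero N] (x : σ → ZMod N) (v : σ) :
    ‖rootPoint x v‖ = 1 := norm_stdAddChar _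

lemma expect_stdAddChar_pow {N : ℕ} [NeZero N] {a b : ℕ} (ha : a < N) (hb : b < N) :
    𝔼 j : ZMod N, (ZMod.stdAddChar j : ℂ) ^ a * (starRingEnd ℂ) ((ZMod.stdAddChar j : ℂ) ^ b)
      = if a = b then 1 else 0 := by
  have h : ∀ j : ZMod N,
      (ZMod.stdAddChar j : ℂ) ^ a * (starRingEnd ℂ) ((ZMod.stdAddChar j : ℂ) ^ b)
        = ZMod.stdAddChar (j * ((a : ZMod N) - (b : ZMod N))) := by
    intro j
    rw [map_pow, ← AddChar.map_neg_eq_conj, ← AddChar.map_nsmul_eq_pow,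
      ← AddChar.map_nsmul_eq_pow, ← AddChar.map_add_eq_mul]
    congr 1
    simp only [nsmul_eq_mul]
    ring
  simp_rw [h]
  rw [Fintype.expect_eq_sum_div_card, AddChar.sum_mulShift _ (ZMod.isPrimitive_stdAddChar N)]
  have hab : ((a : ZMod N) - (b : ZMod N) = 0) ↔ a = b := by
    rw [sub_eq_zero, ZMod.natCast_eq_natCast_iff']
    rw [Nat.mod_eq_of_lt ha, Nat.mod_eq_of_lt hb]
  have hN : (N : ℂ) ≠ 0 := Nat.cast_ne_zero.mpr (NeZero.ne N)
  by_cases e : a = b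
  · simp [e, hN]
  · simp [hab, e]

section torus

variable {σ : Type*} [Fintype σ] [DecidableEq σ]

lemma expect_prod_eq_prod_expect {N : ℕ} [NeZero N] (f : σ → ZMod N → ℂ) :
    𝔼 x : σ → ZMod N, ∏ v, f v (x v) = ∏ v, 𝔼 j, f v j := by
  simp_rw [Fintype.expect_eq_sum_div_card]
  rw [Finset.prod_div_distrib, Finset.prod_univ_sum]
  simp

/-- Parseval's identity over the grid of `N`-th roots of unity. -/
lemma expect_norm_sq_eval (N : ℕ) [NeZero N] (f : MvPolynomial σ ℂ) (hf : f.totalDegree < N) :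
    𝔼 x : σ → ZMod N, ‖MvPolynomial.eval (rootPoint x) f‖ ^ 2
      = ∑ α ∈ f.support, ‖f.coeff α‖ ^ 2 := by
  have hdeg : ∀ α ∈ f.support, ∀ v, α v < N := by
    intro α hα v
    refine lt_of_le_of_lt ?_ (lt_of_le_of_lt (MvPolynomial.le_totalDegree hα) hf)
    rw [Finsupp.sum_fintype _ _ (by simp)]
    exact Finset.single_le_sum (f := fun v => α v) (by simp) (Finset.mem_univ v)
  have key : ((𝔼 x : σ → ZMod N, ‖MvPolynomial.eval (rootPoint x) f‖ ^ 2 : ℝ) : ℂ)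
      = ((∑ α ∈ f.support, ‖f.coeff α‖ ^ 2 : ℝ) : ℂ) := by
    have h1 : ((𝔼 x : σ → ZMod N, ‖MvPolynomial.eval (rootPoint x) f‖ ^ 2 : ℝ) : ℂ)
        = 𝔼 x : σ → ZMod N, ∑ α ∈ f.support, ∑ β ∈ f.support,
          f.coeff α * (starRingEnd ℂ) (f.coeff β) *
            ∏ v, ((ZMod.stdAddChar (x v) : ℂ) ^ (α v) *
              (starRingEnd ℂ) ((ZMod.stdAddChar (x v) : ℂ) ^ (β v))) := by
      rw [Fintype.expect_eq_sum_div_card, Fintype.expect_eq_sum_div_card]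
      push_cast
      congr 1
      refine Finset.sum_congr rfl fun x _ => ?_
      rw [← Complex.mul_conj', MvPolynomial.eval_eq', map_sum, Finset.sum_mul_sum]
      refine Finset.sum_congr rfl fun α _ => Finset.sum_congr rfl fun β _ => ?_
      rw [map_mul, map_prod, Finset.prod_mul_distrib]
      simp only [rootPoint]
      ring
    rw [h1, Finset.expect_sum_comm]
    push_cast
    refine Finset.sum_congr rfl fun α hα => ?_
    rw [Finset.expect_sum_comm, Finset.sum_eq_single α]
    · rw [← Finset.mul_expect, expect_prod_eq_prod_expect (fun v j =>
        (ZMod.stdAddChar j : ℂ) ^ (α v) * (starRingEnd ℂ) ((ZMod.stdAddChar j : ℂ) ^ (α v)))]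
      simp_rw [expect_stdAddChar_pow (hdeg α hα _) (hdeg α hα _)]
      simp [Complex.mul_conj']
    · intro β hβ hne
      rw [← Finset.mul_expect, expect_prod_eq_prod_expect (fun v j =>
        (ZMod.stdAddChar j : ℂ) ^ (α v) * (starRingEnd ℂ) ((ZMod.stdAddChar j : ℂ) ^ (β v)))]
      simp_rw [expect_stdAddChar_pow (hdeg α hα _) (hdeg β hβ _)]
      obtain ⟨v, hv⟩ : ∃ v, α v ≠ β v := by
        by_contra! h
        exact hne (Finsupp.ext h).symm
      rw [Finset.prod_eq_zero (Finset.mem_univ v) (by simp [hv])]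
      simp
    · intro h
      exact absurd hα h
  exact_mod_cast key

omit [Fintype σ] in
lemma card_antidiagonal_le_two_pow (α : σ →₀ ℕ) :
    (Finset.HasAntidiagonal.antidiagonal α).card ≤ 2 ^ (α.degree) := by
  have h1 : (Finset.HasAntidiagonal.antidiagonal α).card ≤ (Finset.Iic α).card := by
    refine Finset.card_le_card_of_injOn Prod.fst ?_ ?_
    · intro p hp
      have := Finset.HasAntidiagonal.mem_antidiagonal.1 (Finset.mem_coe.1 hp)
      simp only [Finset.coe_Iic, Set.mem_Iic]
      rw [← this]
      exact le_self_add
    · intro p hp q hq h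
      have hp' := Finset.HasAntidiagonal.mem_antidiagonal.1 (Finset.mem_coe.1 hp)
      have hq' := Finset.HasAntidiagonal.mem_antidiagonal.1 (Finset.mem_coe.1 hq)
      refine Prod.ext h ?_
      rw [← hq', h] at hp'
      exact add_left_cancel hp'
  refine h1.trans ?_
  rw [Finsupp.card_Iic, Finsupp.degree_apply, ← Finset.prod_pow_eq_pow_sum]
  refine Finset.prod_le_prod' fun v _ => ?_
  simpa using (Nat.lt_two_pow_self (n := α v))

/-- The `L⁴`-norm of a polynomial of degree at most `m` on the torus is at most `√2 ^ m` times its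
`L²`-norm. -/
lemma expect_norm_pow_four_le (N m : ℕ) [NeZero N] (f : MvPolynomial σ ℂ)
    (hf : f.totalDegree ≤ m) (hm : 2 * m < N) :
    𝔼 x : σ → ZMod N, ‖MvPolynomial.eval (rootPoint x) f‖ ^ 4
      ≤ 4 ^ m * (𝔼 x : σ → ZMod N, ‖MvPolynomial.eval (rootPoint x) f‖ ^ 2) ^ 2 := by
  rw [expect_norm_sq_eval N f (by omega)]
  have h1 : ∀ x : σ → ZMod N, ‖MvPolynomial.eval (rootPoint x) f‖ ^ 4
      = ‖MvPolynomial.eval (rootPoint x) (f * f)‖ ^ 2 := by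
    intro x
    rw [map_mul, norm_mul]
    ring
  have hff : (f * f).totalDegree ≤ 2 * m :=
    (MvPolynomial.totalDegree_mul _ _).trans (by omega)
  simp_rw [h1]
  rw [expect_norm_sq_eval N (f * f) (by omega)]
  set g : MvPolynomial σ ℝ :=
    ∑ α ∈ f.support, MvPolynomial.monomial α (‖f.coeff α‖ ^ 2) with hg
  have hgc : ∀ α, g.coeff α = ‖f.coeff α‖ ^ 2 := by
    intro α
    rw [hg, MvPolynomial.coeff_sum]
    simp_rw [MvPolynomial.coeff_monomial]
    rw [Finset.sum_ite_eq' f.support α]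
    split_ifs with h
    · rfl
    · rw [MvPolynomial.notMem_support_iff.1 h]; simp
  have hge : MvPolynomial.eval 1 g = ∑ α ∈ f.support, ‖f.coeff α‖ ^ 2 := by
    rw [hg, map_sum]
    simp [MvPolynomial.eval_monomial]
  have hggc : ∀ α, 0 ≤ (g * g).coeff α := by
    intro α
    rw [MvPolynomial.coeff_mul]
    exact Finset.sum_nonneg fun p _ => by rw [hgc, hgc]; positivity
  calc ∑ α ∈ (f * f).support, ‖(f * f).coeff α‖ ^ 2
      ≤ ∑ α ∈ (f * f).support, 4 ^ m * (g * g).coeff α := by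
        refine Finset.sum_le_sum fun α hα => ?_
        have hdeg : α.degree ≤ 2 * m :=
          le_trans (MvPolynomial.le_totalDegree hα) hff
        rw [MvPolynomial.coeff_mul, MvPolynomial.coeff_mul]
        calc ‖∑ p ∈ Finset.HasAntidiagonal.antidiagonal α, f.coeff p.1 * f.coeff p.2‖ ^ 2
            ≤ (∑ p ∈ Finset.HasAntidiagonal.antidiagonal α, ‖f.coeff p.1 * f.coeff p.2‖) ^ 2 := by
              gcongr; exact norm_sum_le _ _
          _ ≤ (Finset.HasAntidiagonal.antidiagonal α).card *
              ∑ p ∈ Finset.HasAntidiagonal.antidiagonal α, ‖f.coeff p.1 * f.coeff p.2‖ ^ 2 :=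
              sq_sum_le_card_mul_sum_sq
          _ ≤ 4 ^ m * ∑ p ∈ Finset.HasAntidiagonal.antidiagonal α, g.coeff p.1 * g.coeff p.2 := by
              simp_rw [hgc, norm_mul, mul_pow]
              gcongr
              have h2 := (card_antidiagonal_le_two_pow α).trans
                (Nat.pow_le_pow_right (by norm_num) hdeg)
              rw [pow_mul] at h2
              exact_mod_cast h2
    _ = 4 ^ m * ∑ α ∈ (f * f).support, (g * g).coeff α := by rw [← Finset.mul_sum]
    _ ≤ 4 ^ m * ∑ α ∈ (f * f).support ∪ (g * g).support, (g * g).coeff α := by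
        refine mul_le_mul_of_nonneg_left ?_ (by positivity)
        exact Finset.sum_le_sum_of_subset_of_nonneg Finset.subset_union_left
          fun α _ _ => hggc α
    _ = 4 ^ m * ∑ α ∈ (g * g).support, (g * g).coeff α := by
        congr 1
        refine (Finset.sum_subset Finset.subset_union_right fun α _ h => ?_).symm
        exact MvPolynomial.notMem_support_iff.1 h
    _ = 4 ^ m * (∑ α ∈ f.support, ‖f.coeff α‖ ^ 2) ^ 2 := by
        rw [← hge, sq, ← map_mul, MvPolynomial.eval_eq']
        simp

/-- Interpolation between `L^q`, `L²` and `L⁴`: a comparison of `L⁴` with `L²` yields a comparison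
of `L²` with `L^q`. -/
lemma rpow_expect_sq_le {ι : Type*} [Fintype ι] (F : ι → ℝ) (hF0 : ∀ x, 0 ≤ F x) {B : ℝ}
    (hBpos : 0 < B) (h4 : 𝔼 x, F x ^ 4 ≤ B * (𝔼 x, F x ^ 2) ^ 2) {q : ℝ} (hq0 : 0 < q)
    (hq2 : q < 2) :
    (𝔼 x, F x ^ 2) ^ (q / 2) ≤ B ^ (1 - q / 2) * 𝔼 x, F x ^ q := by
  have hV0 : 0 ≤ 𝔼 x, F x ^ 2 := Finset.expect_nonneg fun x _ => by positivity
  obtain ⟨V, hV⟩ : ∃ V, V = 𝔼 x, F x ^ 2 := ⟨_, rfl⟩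
  rw [← hV] at h4 hV0 ⊢
  have hE0 : 0 ≤ 𝔼 x, F x ^ q := Finset.expect_nonneg fun x _ => Real.rpow_nonneg (hF0 x) _
  rcases hV0.eq_or_lt with h0 | hVpos
  · rw [← h0, Real.zero_rpow (by positivity)]
    positivity
  obtain ⟨A, hA⟩ : ∃ A, A = (B * V) ^ (1 - q / 2) := ⟨_, rfl⟩
  have hApos : 0 < A := by rw [hA]; positivity
  obtain ⟨l, hl⟩ : ∃ l, l = 2 / (4 - q) := ⟨_, rfl⟩
  have h4q : 0 < 4 - q := by linarith
  have hl0 : 0 < l := by rw [hl]; positivity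
  have hl1 : 0 < 1 - l := by
    rw [hl, sub_pos, div_lt_one h4q]; linarith
  have pt : ∀ x, F x ^ 2 ≤ l * (A * F x ^ q) + (1 - l) * (F x ^ 4 / (B * V)) := by
    intro x
    have := Real.geom_mean_le_arith_mean2_weighted hl0.le hl1.le
      (p₁ := A * F x ^ q) (p₂ := F x ^ 4 / (B * V))
      (mul_nonneg hApos.le (Real.rpow_nonneg (hF0 x) _)) (by positivity) (by ring)
    refine le_trans (le_of_eq ?_) this
    rcases (hF0 x).eq_or_lt with hx | hx
    · rw [← hx, Real.zero_rpow hq0.ne', mul_zero, Real.zero_rpow hl0.ne']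
      simp
    · rw [Real.mul_rpow hApos.le (by positivity), Real.div_rpow (by positivity) (by positivity),
        hA, ← Real.rpow_mul (by positivity), ← Real.rpow_mul hx.le, ← Real.rpow_natCast (F x) 4,
        ← Real.rpow_mul hx.le]
      have e1 : (1 - q / 2) * l = 1 - l := by rw [hl]; field_simp; ring
      have e2 : F x ^ (q * l) * F x ^ (((4 : ℕ) : ℝ) * (1 - l)) = F x ^ 2 := by
        rw [← Real.rpow_add hx, ← Real.rpow_natCast (F x) 2]
        congr 1
        rw [hl]; field_simp; push_cast; ring
      rw [e1, ← e2]
      field_simp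
  have hholder : V ≤ l * (A * 𝔼 x, F x ^ q) + (1 - l) * V := by
    calc V = 𝔼 x, F x ^ 2 := hV
      _ ≤ 𝔼 x, (l * (A * F x ^ q) + (1 - l) * (F x ^ 4 / (B * V))) :=
          Finset.expect_le_expect fun x _ => pt x
      _ = l * (A * 𝔼 x, F x ^ q) + (1 - l) * ((𝔼 x, F x ^ 4) / (B * V)) := by
          rw [Finset.expect_add_distrib, ← Finset.mul_expect, ← Finset.mul_expect,
            ← Finset.mul_expect, ← Finset.expect_div]
      _ ≤ l * (A * 𝔼 x, F x ^ q) + (1 - l) * V := by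
          gcongr
          rw [div_le_iff₀ (by positivity)]
          calc _ ≤ B * V ^ 2 := h4
            _ = _ := by ring
  have hVA : V ≤ A * 𝔼 x, F x ^ q := by
    have : l * V ≤ l * (A * 𝔼 x, F x ^ q) := by linarith
    exact le_of_mul_le_mul_left this hl0
  rw [hA, Real.mul_rpow hBpos.le hVpos.le] at hVA
  have hsplit : V = V ^ (q / 2) * V ^ (1 - q / 2) := by
    rw [← Real.rpow_add hVpos]; simp
  have hpos : 0 < V ^ (1 - q / 2) := by positivity
  refine le_of_mul_le_mul_right ?_ hpos
  rw [← hsplit]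
  calc V ≤ _ := hVA
    _ = _ := by ring

/-- A Khinchine-type inequality between `L^q` and `L²`, `1 ≤ q < 2`, for polynomials on the
torus. -/
lemma rpow_expect_norm_sq_le (N m : ℕ) [NeZero N] (f : MvPolynomial σ ℂ)
    (hf : f.totalDegree ≤ m) (hm : 2 * m < N) {q : ℝ} (hq0 : 0 < q) (hq2 : q < 2) :
    (𝔼 x : σ → ZMod N, ‖MvPolynomial.eval (rootPoint x) f‖ ^ 2) ^ (q / 2)
      ≤ ((4 : ℝ) ^ m) ^ (1 - q / 2) *
        𝔼 x : σ → ZMod N, ‖MvPolynomial.eval (rootPoint x) f‖ ^ q := by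
  exact rpow_expect_sq_le _ (fun x => norm_nonneg _) (by positivity)
    (expect_norm_pow_four_le N m f hf hm) hq0 hq2

end torus

/-- A block version of Blei's inequality: the `ℓ^{2m/(m+1)}`-norm of an array is controlled by
its mixed `(ℓ^{2kₛ/(kₛ+1)}, ℓ²)`-norms, where the `kₛ` add up to `m`. -/
lemma sum_rpow_le_prod_of_mixed {J : Type*} [Fintype J] [DecidableEq J] [Nonempty J]
    {X : J → Type*} [∀ s, Fintype (X s)] [∀ s, DecidableEq (X s)] (k : J → ℝ) (hk : ∀ s, 0 < k s)
    (b : (∀ s, X s) → ℝ) (hb : ∀ x, 0 ≤ b x) (K : J → ℝ) (hK : ∀ s, 0 < K s)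
    (hF : ∀ s, ∑ y : X s, (∑ x with x s = y, b x ^ 2) ^ (k s / (k s + 1)) ≤ K s) :
    ∑ x, b x ^ (2 * (∑ s, k s) / ((∑ s, k s) + 1))
      ≤ ∏ s, K s ^ ((k s + 1) / ((∑ s, k s) + 1)) := by
  obtain ⟨m, hm⟩ : ∃ m, m = ∑ s, k s := ⟨_, rfl⟩
  rw [← hm]
  have hm0 : 0 < m := by rw [hm]; exact Finset.sum_pos (fun s _ => hk s) Finset.univ_nonempty
  obtain ⟨G, hG⟩ : ∃ G : ∀ s, X s → ℝ, ∀ s y, G s y = ∑ x with x s = y, b x ^ 2 :=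
    ⟨fun s y => ∑ x with x s = y, b x ^ 2, fun _ _ => rfl⟩
  simp_rw [← hG] at hF
  have hG0 : ∀ s y, 0 ≤ G s y := fun s y => by
    rw [hG]; exact Finset.sum_nonneg fun x _ => by positivity
  have hbG : ∀ s x, b x ^ 2 ≤ G s (x s) := fun s x => by
    rw [hG]
    exact Finset.single_le_sum (f := fun x => b x ^ 2) (fun x _ => by positivity) (by simp)
  obtain ⟨D, hD⟩ : ∃ D, D = ∏ s, K s ^ ((k s + 1) / (m + 1)) := ⟨_, rfl⟩
  rw [← hD]
  have hD0 : 0 < D := by rw [hD]; exact Finset.prod_pos fun s _ => Real.rpow_pos_of_pos (hK s) _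
  have pt : ∀ x, b x ^ (2 * m / (m + 1)) ≤ D *
      (∑ s, k s / (m + 1) * (b x ^ 2 * G s (x s) ^ (-1 / (k s + 1)) / K s)
        + 1 / (m + 1) * ∏ s, (G s (x s) ^ (k s / (k s + 1)) / K s)) := by
    intro x
    have hu : ∀ s, 0 ≤ b x ^ 2 * G s (x s) ^ (-1 / (k s + 1)) / K s := fun s =>
      div_nonneg (mul_nonneg (by positivity) (Real.rpow_nonneg (hG0 _ _) _)) (hK s).le
    have hv : ∀ s, 0 ≤ G s (x s) ^ (k s / (k s + 1)) / K s := fun s =>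
      div_nonneg (Real.rpow_nonneg (hG0 _ _) _) (hK s).le
    have amgm := Real.geom_mean_le_arith_mean_weighted (Finset.univ : Finset (Option J))
      (fun o => o.elim (1 / (m + 1)) (fun s => k s / (m + 1)))
      (fun o => o.elim (∏ s, (G s (x s) ^ (k s / (k s + 1)) / K s))
        (fun s => b x ^ 2 * G s (x s) ^ (-1 / (k s + 1)) / K s))
      (by rintro (_ | s) _
          · simp only [Option.elim]; positivity
          · simp only [Option.elim]; exact div_nonneg (hk s).le (by positivity))
      (by rw [Fintype.sum_option]
          simp only [Option.elim]
          rw [← Finset.sum_div, ← hm]; field_simp; ring)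
      (by rintro (_ | s) _
          · exact Finset.prod_nonneg fun s _ => hv s
          · exact hu s)
    rw [Fintype.prod_option, Fintype.sum_option] at amgm
    simp only [Option.elim] at amgm
    rcases (hb x).eq_or_lt with h0 | hpos
    · rw [← h0, Real.zero_rpow (by positivity)]
      refine mul_nonneg hD0.le (add_nonneg (Finset.sum_nonneg fun s _ => mul_nonneg
        (div_nonneg (hk s).le (by positivity)) ?_)
        (mul_nonneg (by positivity) (Finset.prod_nonneg fun s _ => hv s)))
      have := hu s
      rwa [← h0] at this
    · refine le_trans (le_of_eq ?_)
        (mul_le_mul_of_nonneg_left (amgm.trans_eq (add_comm _ _)) hD0.le)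
      rw [← Real.finsetProd_rpow _ _ (fun s _ => hv s), ← Finset.prod_mul_distrib, hD,
        ← Finset.prod_mul_distrib]
      have hGpos : ∀ s, 0 < G s (x s) := fun s => lt_of_lt_of_le (by positivity) (hbG s x)
      have per : ∀ s, K s ^ ((k s + 1) / (m + 1)) *
          ((G s (x s) ^ (k s / (k s + 1)) / K s) ^ (1 / (m + 1)) *
            (b x ^ 2 * G s (x s) ^ (-1 / (k s + 1)) / K s) ^ (k s / (m + 1)))
          = b x ^ (2 * (k s / (m + 1))) := by
        intro s
        have h1 := hGpos s
        have h2 := hK s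
        have h3 := hk s
        rw [Real.div_rpow (by positivity) h2.le, Real.div_rpow (by positivity) h2.le,
          Real.mul_rpow (by positivity) (by positivity), ← Real.rpow_mul h1.le,
          ← Real.rpow_mul h1.le, ← Real.rpow_natCast (b x) 2, ← Real.rpow_mul hpos.le]
        have e1 : G s (x s) ^ (k s / (k s + 1) * (1 / (m + 1))) *
            G s (x s) ^ (-1 / (k s + 1) * (k s / (m + 1))) = 1 := by
          rw [← Real.rpow_add h1]
          convert Real.rpow_zero _ using 2
          field_simp
          ring
        have e2 : K s ^ ((k s + 1) / (m + 1)) = K s ^ (1 / (m + 1)) * K s ^ (k s / (m + 1)) := by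
          rw [← Real.rpow_add h2]; congr 1; ring
        have h4 : K s ^ (1 / (m + 1)) ≠ 0 := (Real.rpow_pos_of_pos h2 _).ne'
        have h5 : K s ^ (k s / (m + 1)) ≠ 0 := (Real.rpow_pos_of_pos h2 _).ne'
        rw [e2]
        calc _ = (G s (x s) ^ (k s / (k s + 1) * (1 / (m + 1))) *
            G s (x s) ^ (-1 / (k s + 1) * (k s / (m + 1)))) *
              b x ^ (((2 : ℕ) : ℝ) * (k s / (m + 1))) := by field_simp
          _ = _ := by rw [e1, one_mul]; push_cast; rfl
      simp_rw [per]
      rw [← Real.rpow_sum_of_pos hpos, ← Finset.mul_sum, ← Finset.sum_div, ← hm]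
      congr 1
      ring
  have s1 : ∀ s, ∑ x, b x ^ 2 * G s (x s) ^ (-1 / (k s + 1)) / K s ≤ 1 := by
    intro s
    rw [← Finset.sum_div, div_le_one (hK s)]
    refine le_trans (le_of_eq ?_) (hF s)
    rw [← Finset.sum_fiberwise (s := Finset.univ) (g := fun x => x s)]
    refine Finset.sum_congr rfl fun y _ => ?_
    have : ∑ x with x s = y, b x ^ 2 * G s (x s) ^ (-1 / (k s + 1))
        = G s y * G s y ^ (-1 / (k s + 1)) := by
      nth_rewrite 1 [hG s y]
      rw [Finset.sum_mul]
      refine Finset.sum_congr rfl fun x hx => ?_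
      rw [(Finset.mem_filter.1 hx).2]
    rw [this]
    have hks := hk s
    rcases (hG0 s y).eq_or_lt with h | h
    · rw [← h, zero_mul, Real.zero_rpow (by positivity)]
    · nth_rewrite 1 [← Real.rpow_one (G s y)]
      rw [← Real.rpow_add h]
      congr 1
      field_simp
      ring
  have s2 : ∑ x : ∀ s, X s, ∏ s, (G s (x s) ^ (k s / (k s + 1)) / K s) ≤ 1 := by
    have := Finset.prod_univ_sum (fun s => (Finset.univ : Finset (X s)))
      (fun s y => G s y ^ (k s / (k s + 1)) / K s)
    rw [Fintype.piFinset_univ] at this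
    rw [← this]
    refine Finset.prod_le_one (fun s _ => Finset.sum_nonneg fun y _ =>
      div_nonneg (Real.rpow_nonneg (hG0 _ _) _) (hK s).le) fun s _ => ?_
    rw [← Finset.sum_div, div_le_one (hK s)]
    exact hF s
  calc ∑ x, b x ^ (2 * m / (m + 1)) ≤ ∑ x, D *
      (∑ s, k s / (m + 1) * (b x ^ 2 * G s (x s) ^ (-1 / (k s + 1)) / K s)
        + 1 / (m + 1) * ∏ s, (G s (x s) ^ (k s / (k s + 1)) / K s)) :=
        Finset.sum_le_sum fun x _ => pt x
    _ = D * (∑ s, k s / (m + 1) * (∑ x, b x ^ 2 * G s (x s) ^ (-1 / (k s + 1)) / K s)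
        + 1 / (m + 1) * ∑ x : ∀ s, X s, ∏ s, (G s (x s) ^ (k s / (k s + 1)) / K s)) := by
        rw [← Finset.mul_sum, Finset.sum_add_distrib, Finset.sum_comm, ← Finset.mul_sum]
        simp_rw [← Finset.mul_sum]
    _ ≤ D * (∑ s, k s / (m + 1) * 1 + 1 / (m + 1) * 1) := by
        refine mul_le_mul_of_nonneg_left (add_le_add (Finset.sum_le_sum fun s _ =>
          mul_le_mul_of_nonneg_left (s1 s) (div_nonneg (hk s).le (by positivity)))
          (mul_le_mul_of_nonneg_left s2 (by positivity))) hD0.le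
    _ = D := by
        simp_rw [mul_one]
        rw [← Finset.sum_div, ← hm]
        field_simp

/-- A Bohnenblust–Hille inequality for `k`-linear forms in finitely many variables. -/
lemma multilinear_bohnenblust_hille {σ : Type*} [Fintype σ] [DecidableEq σ] {k : ℕ} (hk : 0 < k)
    (c : (Fin k → σ) → ℂ) {M : ℝ} (hM0 : 0 < M)
    (hM : ∀ w : Fin k → σ → ℂ, (∀ j v, ‖w j v‖ = 1) → ‖∑ y, c y * ∏ j, w j (y j)‖ ≤ M) :
    ∑ y, ‖c y‖ ^ (2 * (k : ℝ) / (k + 1)) ≤ (2 ^ k * M) ^ (2 * (k : ℝ) / (k + 1)) := by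
  have : Nonempty (Fin k) := ⟨⟨0, hk⟩⟩
  obtain ⟨e, he⟩ : ∃ e : (Fin k → σ) → (Fin k × σ →₀ ℕ),
      ∀ y, e y = ∑ j, Finsupp.single (j, y j) 1 := ⟨_, fun _ => rfl⟩
  have hinj : Function.Injective e := by
    intro y y' h
    funext j
    have h1 : e y (j, y' j) = e y' (j, y' j) := by rw [h]
    rw [he, he] at h1
    simp only [Finsupp.coe_finsetSum, Finset.sum_apply, Finsupp.single_apply, Prod.mk.injEq] at h1
    rw [Finset.sum_eq_single j (by intro i _ hi; simp [hi]) (by simp),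
      Finset.sum_eq_single j (by intro i _ hi; simp [hi]) (by simp)] at h1
    by_contra hne
    simp [hne] at h1
  have hdeg : ∀ y, (e y).degree = k := by
    intro y
    rw [he]
    simp
  have mixed : ∀ s : Fin k, ∑ v : σ, (∑ y with y s = v, ‖c y‖ ^ 2) ^ ((1 : ℝ) / (1 + 1))
      ≤ 2 ^ k * M := by
    intro s
    obtain ⟨f, hf⟩ : ∃ f : σ → MvPolynomial (Fin k × σ) ℂ,
      ∀ v, f v = ∑ y with y s = v, MvPolynomial.monomial (e y) (c y) := ⟨_, fun _ => rfl⟩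
    have hfdeg : ∀ v, (f v).totalDegree ≤ k := by
      intro v
      rw [hf]
      refine MvPolynomial.totalDegree_finsetSum_le fun y _ => ?_
      exact (MvPolynomial.totalDegree_monomial_le _ _).trans (hdeg y).le
    have hcoeff : ∀ v y, y s = v → (f v).coeff (e y) = c y := by
      intro v y hy
      rw [hf, MvPolynomial.coeff_sum]
      simp_rw [MvPolynomial.coeff_monomial, hinj.eq_iff]
      rw [Finset.sum_ite_eq']
      simp [hy]
    have heval : ∀ v (z : Fin k × σ → ℂ), MvPolynomial.eval z (f v)
        = ∑ y with y s = v, c y * ∏ j, z (j, y j) := by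
      intro v z
      rw [hf, map_sum]
      refine Finset.sum_congr rfl fun y _ => ?_
      rw [MvPolynomial.eval_monomial, he, Finsupp.prod_fintype _ _ (by simp)]
      congr 1
      simp only [Finsupp.coe_finsetSum, Finset.sum_apply, ← Finset.prod_pow_eq_pow_sum]
      rw [Finset.prod_comm]
      refine Finset.prod_congr rfl fun j _ => ?_
      rw [Finset.prod_eq_single (j, y j)]
      · simp
      · intro i _ hi
        rw [Finsupp.single_eq_of_ne hi, pow_zero]
      · simp
    have hv : ∀ v, (∑ y with y s = v, ‖c y‖ ^ 2) ^ ((1 : ℝ) / (1 + 1))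
        ≤ 2 ^ k * 𝔼 x : Fin k × σ → ZMod (2 * k + 1),
          ‖MvPolynomial.eval (rootPoint x) (f v)‖ := by
      intro v
      have h := rpow_expect_norm_sq_le (2 * k + 1) k (f v) (hfdeg v) (by omega)
        (q := 1) (by norm_num) (by norm_num)
      rw [expect_norm_sq_eval _ _ (lt_of_le_of_lt (hfdeg v) (by omega))] at h
      simp_rw [Real.rpow_one] at h
      have h2 : ((4 : ℝ) ^ k) ^ (1 - (1 : ℝ) / 2) = 2 ^ k := by
        rw [show (4 : ℝ) ^ k = (2 ^ k) ^ (2 : ℝ) by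
          rw [Real.rpow_two, ← pow_mul, mul_comm, pow_mul]; norm_num, ← Real.rpow_mul (by positivity)]
        norm_num
      rw [h2] at h
      refine le_trans ?_ h
      rw [show (1 : ℝ) / (1 + 1) = 1 / 2 by norm_num]
      refine Real.rpow_le_rpow (Finset.sum_nonneg fun y _ => by positivity) ?_ (by norm_num)
      calc ∑ y with y s = v, ‖c y‖ ^ 2
          = ∑ y with y s = v, ‖(f v).coeff (e y)‖ ^ 2 := by
            refine Finset.sum_congr rfl fun y hy => ?_
            rw [hcoeff v y (Finset.mem_filter.1 hy).2]
        _ = ∑ α ∈ (Finset.univ.filter fun y => y s = v).image e, ‖(f v).coeff α‖ ^ 2 := by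
            rw [Finset.sum_image fun _ _ _ _ h => hinj h]
        _ ≤ ∑ α ∈ (Finset.univ.filter fun y => y s = v).image e ∪ (f v).support,
              ‖(f v).coeff α‖ ^ 2 :=
            Finset.sum_le_sum_of_subset_of_nonneg Finset.subset_union_left
              fun α _ _ => by positivity
        _ = ∑ α ∈ (f v).support, ‖(f v).coeff α‖ ^ 2 := by
            refine (Finset.sum_subset Finset.subset_union_right fun α _ h => ?_).symm
            rw [MvPolynomial.notMem_support_iff.1 h]
            simp
    refine (Finset.sum_le_sum fun v _ => hv v).trans ?_
    rw [← Finset.mul_sum, ← Finset.expect_sum_comm]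
    refine mul_le_mul_of_nonneg_left ?_ (by positivity)
    refine Finset.expect_le Finset.univ_nonempty fun x _ => ?_
    obtain ⟨ε, hε⟩ : ∃ ε : σ → ℂ, ∀ v, ‖ε v‖ = 1 ∧
        (‖MvPolynomial.eval (rootPoint x) (f v)‖ : ℂ)
          = ε v * MvPolynomial.eval (rootPoint x) (f v) := by
      choose ε hε using fun v => Complex.exists_norm_eq_mul_self
        (MvPolynomial.eval (rootPoint x) (f v))
      exact ⟨ε, hε⟩
    have hL := hM (fun j v => if j = s then ε v * rootPoint x (j, v) else rootPoint x (j, v))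
      (by
        intro j v
        split_ifs
        · rw [norm_mul, (hε v).1, norm_rootPoint, one_mul]
        · exact norm_rootPoint _ _)
    have hsum : ∑ y, c y * ∏ j, (if j = s then ε (y j) * rootPoint x (j, y j)
          else rootPoint x (j, y j))
        = ((∑ v, ‖MvPolynomial.eval (rootPoint x) (f v)‖ : ℝ) : ℂ) := by
      push_cast
      rw [← Finset.sum_fiberwise (s := Finset.univ) (g := fun y : Fin k → σ => y s)]
      refine Finset.sum_congr rfl fun v _ => ?_
      rw [(hε v).2, heval, Finset.mul_sum]
      refine Finset.sum_congr rfl fun y hy => ?_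
      have hys : y s = v := (Finset.mem_filter.1 hy).2
      rw [← Finset.mul_prod_erase Finset.univ _ (Finset.mem_univ s),
        ← Finset.mul_prod_erase Finset.univ (fun j => rootPoint x (j, y j)) (Finset.mem_univ s)]
      rw [Finset.prod_congr rfl (g := fun j => rootPoint x (j, y j))
        (fun j hj => if_neg (Finset.ne_of_mem_erase hj))]
      rw [if_pos rfl, hys]
      ring
    rw [hsum, Complex.norm_real] at hL
    exact (le_abs_self _).trans hL
  have h := sum_rpow_le_prod_of_mixed (J := Fin k) (X := fun _ => σ) (fun _ => 1)
    (fun _ => one_pos) (fun y => ‖c y‖) (fun _ => norm_nonneg _) (fun _ => 2 ^ k * M)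
    (fun _ => by positivity) mixed
  simp only [Finset.sum_const, Finset.card_univ, Fintype.card_fin, nsmul_eq_mul, mul_one,
    Finset.prod_const] at h
  refine h.trans (le_of_eq ?_)
  rw [← Real.rpow_natCast, ← Real.rpow_mul (by positivity)]
  congr 1
  ring

section derivatives

variable {σ : Type*} [Fintype σ] [DecidableEq σ]

/-- The iterated partial derivative of a polynomial along the variables `y 0, …, y (k - 1)`. -/
noncomputable def iterPderiv {σ : Type*} :
    (k : ℕ) → (Fin k → σ) → MvPolynomial σ ℂ → MvPolynomial σ ℂ
  | 0, _, P => P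
  | k + 1, y, P => MvPolynomial.pderiv (y 0) (iterPderiv k (Fin.tail y) P)

/-- The derivative of a polynomial in the direction `w`. -/
noncomputable def dirDeriv {σ : Type*} [Fintype σ] (w : σ → ℂ) (P : MvPolynomial σ ℂ) :
    MvPolynomial σ ℂ :=
  ∑ v, MvPolynomial.C (w v) * MvPolynomial.pderiv v P

/-- The iterated derivative of a polynomial in the directions `w 0, …, w (k - 1)`. -/
noncomputable def iterDirDeriv {σ : Type*} [Fintype σ] :
    (k : ℕ) → (Fin k → σ → ℂ) → MvPolynomial σ ℂ → MvPolynomial σ ℂ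
  | 0, _, P => P
  | k + 1, w, P => dirDeriv (w 0) (iterDirDeriv k (Fin.tail w) P)

omit [DecidableEq σ] in
lemma iterDirDeriv_eq_sum (k : ℕ) (w : Fin k → σ → ℂ) (P : MvPolynomial σ ℂ) :
    iterDirDeriv k w P = ∑ y : Fin k → σ,
      MvPolynomial.C (∏ j, w j (y j)) * iterPderiv k y P := by
  induction k with
  | zero => simp [iterDirDeriv, iterPderiv]
  | succ k ih =>
    rw [iterDirDeriv, ih, dirDeriv, ← (Fin.consEquiv (fun _ => σ)).sum_comp, Fintype.sum_prod_type]
    refine Finset.sum_congr rfl fun v _ => ?_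
    rw [map_sum, Finset.mul_sum]
    refine Finset.sum_congr rfl fun y _ => ?_
    rw [MvPolynomial.pderiv_C_mul, Fin.prod_univ_succ]
    simp only [Fin.consEquiv, Equiv.coe_fn_mk, Fin.cons_zero, Fin.cons_succ, iterPderiv,
      Fin.tail_cons, map_mul, Fin.tail]
    rw [mul_assoc]

omit [DecidableEq σ] in
lemma hasDerivAt_eval_add_mul (z w : σ → ℂ) (P : MvPolynomial σ ℂ) (t : ℂ) :
    HasDerivAt (fun t : ℂ => MvPolynomial.eval (fun v => z v + t * w v) P)
      (MvPolynomial.eval (fun v => z v + t * w v) (dirDeriv w P)) t := by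
  classical
  induction P using MvPolynomial.induction_on with
  | C a => simpa [dirDeriv] using hasDerivAt_const t a
  | add p q hp hq =>
    have := hp.add hq
    simp only [dirDeriv, map_add, mul_add, Finset.sum_add_distrib] at this ⊢
    exact this
  | mul_X p v hp =>
    have hX : HasDerivAt (fun t : ℂ => z v + t * w v) (w v) t := by
      simpa using ((hasDerivAt_id t).mul_const (w v)).const_add (z v)
    have h1 : dirDeriv w (p * MvPolynomial.X v)
        = dirDeriv w p * MvPolynomial.X v + p * MvPolynomial.C (w v) := by
      simp only [dirDeriv, Derivation.leibniz, MvPolynomial.pderiv_X, smul_eq_mul, mul_add,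
        Finset.sum_add_distrib]
      rw [Finset.sum_mul, add_comm]
      congr 1
      · refine Finset.sum_congr rfl fun u _ => ?_
        ring
      · rw [Finset.sum_eq_single v]
        · simp; ring
        · intro u _ hu
          simp [hu.symm]
        · simp
    rw [h1]
    simp only [map_mul, map_add, MvPolynomial.eval_X, MvPolynomial.eval_C]
    exact hp.mul hX

omit [DecidableEq σ] in
/-- Cauchy's estimate for a directional derivative on a product of annuli. -/
lemma norm_eval_dirDeriv_le {δ t M : ℝ} (ht : 0 < t) (P : MvPolynomial σ ℂ)
    (hP : ∀ z : σ → ℂ, (∀ v, 1 - (δ + t) ≤ ‖z v‖ ∧ ‖z v‖ ≤ 1 + (δ + t)) →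
      ‖MvPolynomial.eval z P‖ ≤ M) (w : σ → ℂ) (hw : ∀ v, ‖w v‖ = 1)
    (z : σ → ℂ) (hz : ∀ v, 1 - δ ≤ ‖z v‖ ∧ ‖z v‖ ≤ 1 + δ) :
    ‖MvPolynomial.eval z (dirDeriv w P)‖ ≤ M / t := by
  have hd := hasDerivAt_eval_add_mul z w P
  have h0 := (hd 0).deriv
  simp only [zero_mul, add_zero] at h0
  rw [← h0]
  refine Complex.norm_deriv_le_of_forall_mem_sphere_norm_le ht ?_ ?_
  · exact (Differentiable.diffContOnCl fun u => (hd u).differentiableAt)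
  · intro u hu
    refine hP _ fun v => ?_
    have hu' : ‖u * w v‖ = t := by
      rw [norm_mul, hw, mul_one]; simpa using hu
    have h1 := norm_add_le (z v) (u * w v)
    have h2 := norm_sub_le (z v + u * w v) (u * w v)
    rw [add_sub_cancel_right] at h2
    have h3 := hz v
    constructor <;> linarith

omit [DecidableEq σ] in
lemma norm_eval_iterDirDeriv_le {t M : ℝ} (ht : 0 < t) (P : MvPolynomial σ ℂ) (k : ℕ)
    {δ : ℝ} (hP : ∀ z : σ → ℂ, (∀ v, 1 - (δ + k * t) ≤ ‖z v‖ ∧ ‖z v‖ ≤ 1 + (δ + k * t)) →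
      ‖MvPolynomial.eval z P‖ ≤ M) (w : Fin k → σ → ℂ) (hw : ∀ j v, ‖w j v‖ = 1)
    (z : σ → ℂ) (hz : ∀ v, 1 - δ ≤ ‖z v‖ ∧ ‖z v‖ ≤ 1 + δ) :
    ‖MvPolynomial.eval z (iterDirDeriv k w P)‖ ≤ M / t ^ k := by
  induction k generalizing δ z with
  | zero => simpa [iterDirDeriv] using hP z (by simpa using hz)
  | succ k ih =>
    rw [iterDirDeriv, pow_succ, ← div_div]
    refine norm_eval_dirDeriv_le (δ := δ) ht _ (fun z' hz' => ?_) _ (hw 0) z hz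
    refine ih (δ := δ + t) (fun z'' hz'' => hP z'' fun v => ?_) _ (fun j v => hw _ _) z' hz'
    have := hz'' v
    push_cast
    constructor <;> linarith [this.1, this.2]

omit [Fintype σ] [DecidableEq σ] in
lemma norm_coeff_le_norm_coeff_iterPderiv (k : ℕ) (y : Fin k → σ) (P : MvPolynomial σ ℂ)
    (β : σ →₀ ℕ) :
    ‖P.coeff (β + ∑ j, Finsupp.single (y j) 1)‖ ≤ ‖(iterPderiv k y P).coeff β‖ := by
  induction k generalizing β with
  | zero => simp [iterPderiv]
  | succ k ih =>
    rw [iterPderiv, MvPolynomial.coeff_pderiv, Fin.sum_univ_succ, ← add_assoc, norm_mul]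
    refine (ih (Fin.tail y) _).trans ?_
    refine le_mul_of_one_le_right (norm_nonneg _) ?_
    have : ((β (y 0) : ℂ) + 1) = ((β (y 0) + 1 : ℕ) : ℂ) := by push_cast; rfl
    rw [this, Complex.norm_natCast]
    push_cast
    linarith [Nat.cast_nonneg (α := ℝ) (β (y 0))]

omit [Fintype σ] [DecidableEq σ] in
lemma totalDegree_iterPderiv_le (k : ℕ) (y : Fin k → σ) (P : MvPolynomial σ ℂ) :
    (iterPderiv k y P).totalDegree ≤ P.totalDegree := by
  induction k with
  | zero => simp [iterPderiv]
  | succ k ih =>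
    refine le_trans ?_ (ih (Fin.tail y))
    rw [iterPderiv]
    refine Finset.sup_le fun β hβ => ?_
    have h : β + Finsupp.single (y 0) 1 ∈ (iterPderiv k (Fin.tail y) P).support := by
      rw [MvPolynomial.mem_support_iff, MvPolynomial.coeff_pderiv] at hβ
      exact MvPolynomial.mem_support_iff.2 (left_ne_zero_of_mul hβ)
    refine le_trans ?_ (MvPolynomial.le_totalDegree h)
    change β.degree ≤ (β + Finsupp.single (y 0) 1).degree
    rw [map_add]
    exact Nat.le_add_right _ _

/-- The mixed-norm estimate for the coefficients of a polynomial bounded on a product of annuli. -/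
lemma sum_rpow_coeff_mixed_le {k m : ℕ} (hk : 0 < k) {t M : ℝ} (ht : 0 < t) (hM0 : 0 < M)
    (P : MvPolynomial σ ℂ) (hPm : P.totalDegree ≤ m)
    (hP : ∀ z : σ → ℂ, (∀ v, 1 - k * t ≤ ‖z v‖ ∧ ‖z v‖ ≤ 1 + k * t) →
      ‖MvPolynomial.eval z P‖ ≤ M) :
    ∑ y : Fin k → σ, (∑ α ∈ P.support with ∑ j, Finsupp.single (y j) 1 ≤ α,
        ‖P.coeff α‖ ^ 2) ^ ((k : ℝ) / (k + 1))
      ≤ ((4 : ℝ) ^ m) ^ (1 / ((k : ℝ) + 1)) * (2 ^ k * (M / t ^ k)) ^ (2 * (k : ℝ) / (k + 1)) := by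
  have hk0 : (0 : ℝ) < k := by exact_mod_cast hk
  have per : ∀ y : Fin k → σ, (∑ α ∈ P.support with ∑ j, Finsupp.single (y j) 1 ≤ α,
        ‖P.coeff α‖ ^ 2) ^ ((k : ℝ) / (k + 1))
      ≤ ((4 : ℝ) ^ m) ^ (1 / ((k : ℝ) + 1)) * 𝔼 x : σ → ZMod (2 * m + 1),
        ‖MvPolynomial.eval (rootPoint x) (iterPderiv k y P)‖ ^ (2 * (k : ℝ) / (k + 1)) := by
    intro y
    have hdeg : (iterPderiv k y P).totalDegree ≤ m := (totalDegree_iterPderiv_le k y P).trans hPm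
    have h := rpow_expect_norm_sq_le (2 * m + 1) m (iterPderiv k y P) hdeg (by omega)
      (q := 2 * (k : ℝ) / (k + 1)) (by positivity) (by rw [div_lt_iff₀ (by positivity)]; linarith)
    rw [expect_norm_sq_eval _ _ (lt_of_le_of_lt hdeg (by omega))] at h
    have e1 : 2 * (k : ℝ) / (k + 1) / 2 = k / (k + 1) := by ring
    have e2 : 1 - (k : ℝ) / (k + 1) = 1 / (k + 1) := by field_simp; ring
    rw [e1, e2] at h
    refine le_trans (Real.rpow_le_rpow (Finset.sum_nonneg fun _ _ => by positivity) ?_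
      (by positivity)) h
    obtain ⟨e, he⟩ : ∃ e : σ →₀ ℕ, e = ∑ j, Finsupp.single (y j) 1 := ⟨_, rfl⟩
    have hc : ∀ β, ‖P.coeff (β + e)‖ ≤ ‖(iterPderiv k y P).coeff β‖ := fun β => by
      rw [he]; exact norm_coeff_le_norm_coeff_iterPderiv k y P β
    rw [← he]
    have hinj : Set.InjOn (fun α : σ →₀ ℕ => α - e) (P.support.filter fun α => e ≤ α) := by
      intro α hα β hβ h
      have hα' := (Finset.mem_filter.1 (Finset.mem_coe.1 hα)).2
      have hβ' := (Finset.mem_filter.1 (Finset.mem_coe.1 hβ)).2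
      rw [← tsub_add_cancel_of_le hα', ← tsub_add_cancel_of_le hβ']
      exact congrArg (· + e) h
    calc ∑ α ∈ P.support with e ≤ α, ‖P.coeff α‖ ^ 2
        ≤ ∑ α ∈ P.support with e ≤ α, ‖(iterPderiv k y P).coeff (α - e)‖ ^ 2 := by
          refine Finset.sum_le_sum fun α hα => ?_
          have := hc (α - e)
          rw [tsub_add_cancel_of_le (Finset.mem_filter.1 hα).2] at this
          gcongr
      _ = ∑ β ∈ (P.support.filter fun α => e ≤ α).image (fun α => α - e),
            ‖(iterPderiv k y P).coeff β‖ ^ 2 := by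
          rw [Finset.sum_image hinj]
      _ ≤ ∑ β ∈ (iterPderiv k y P).support, ‖(iterPderiv k y P).coeff β‖ ^ 2 := by
          rw [← Finset.sum_filter_ne_zero]
          refine Finset.sum_le_sum_of_subset_of_nonneg (fun β hβ => ?_) fun _ _ _ => by positivity
          rw [MvPolynomial.mem_support_iff]
          intro h0
          simp [h0] at hβ
  refine (Finset.sum_le_sum fun y _ => per y).trans ?_
  rw [← Finset.mul_sum, ← Finset.expect_sum_comm]
  refine mul_le_mul_of_nonneg_left ?_ (by positivity)
  refine Finset.expect_le Finset.univ_nonempty fun x _ => ?_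
  refine multilinear_bohnenblust_hille hk _ (by positivity) fun w hw => ?_
  have h := norm_eval_iterDirDeriv_le ht P k (δ := 0) (by simpa using hP) w hw (rootPoint x)
    (fun v => by simp [norm_rootPoint])
  rw [iterDirDeriv_eq_sum, map_sum] at h
  simp only [map_mul, MvPolynomial.eval_C] at h
  simpa only [mul_comm] using h

end derivatives

lemma exists_fin_sum_single_eq {σ : Type*} (n : ℕ) (α : σ →₀ ℕ) (h : α.degree = n) :
    ∃ f : Fin n → σ, ∑ i, Finsupp.single (f i) 1 = α := by
  induction n generalizing α with
  | zero =>
    refine ⟨Fin.elim0, ?_⟩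
    rw [Finsupp.degree_eq_zero_iff] at h
    simp [h]
  | succ n ih =>
    obtain ⟨v, hv⟩ : ∃ v, α v ≠ 0 := by
      by_contra! h0
      rw [show α = 0 from Finsupp.ext h0] at h
      simp at h
    have hle : Finsupp.single v 1 ≤ α := by
      classical
      rw [Finsupp.single_le_iff]
      omega
    have hsplit : Finsupp.single v 1 + (α - Finsupp.single v 1) = α := add_tsub_cancel_of_le hle
    have hdeg : (α - Finsupp.single v 1).degree = n := by
      have := congrArg Finsupp.degree hsplit
      rw [map_add, h, Finsupp.degree_single] at this
      omega
    obtain ⟨f, hf⟩ := ih _ hdeg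
    refine ⟨Fin.cons v f, ?_⟩
    rw [Fin.sum_univ_succ]
    simpa [hf] using hsplit

lemma exists_sum_single_eq {σ I : Type*} [Fintype I] (α : σ →₀ ℕ)
    (h : α.degree = Fintype.card I) : ∃ f : I → σ, ∑ i, Finsupp.single (f i) 1 = α := by
  obtain ⟨f, hf⟩ := exists_fin_sum_single_eq _ α h
  refine ⟨fun i => f (Fintype.equivFin I i), ?_⟩
  rw [← hf]
  exact (Fintype.equivFin I).sum_comp (fun j => Finsupp.single (f j) 1)

/-- A Bohnenblust–Hille inequality for homogeneous polynomials of degree `m` that are bounded on a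
product of annuli, with a constant depending on a splitting of `m` into blocks. -/
lemma homogeneous_bohnenblust_hille {σ : Type*} [Fintype σ] [DecidableEq σ]
    {J : Type*} [Fintype J] [DecidableEq J] [Nonempty J] (P : MvPolynomial σ ℂ) {m : ℕ}
    (hPm : ∀ α ∈ P.support, α.degree = m) (k : J → ℕ) (hk : ∀ s, 0 < k s)
    (hkm : ∑ s, k s = m) {κ : ℕ} (hκ : ∀ s, k s ≤ κ) {t M : ℝ} (ht : 0 < t) (ht2 : t ≤ 2)
    (hM0 : 0 < M) (hP : ∀ z : σ → ℂ, (∀ v, 1 - κ * t ≤ ‖z v‖ ∧ ‖z v‖ ≤ 1 + κ * t) →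
      ‖MvPolynomial.eval z P‖ ≤ M) :
    (∑ α ∈ P.support, ‖P.coeff α‖ ^ (2 * (m : ℝ) / (m + 1))) ^ (((m : ℝ) + 1) / (2 * m))
      ≤ 2 ^ Fintype.card J * ((2 / t) ^ κ * M) := by
  have hm : 0 < m := by
    rw [← hkm]; exact Finset.sum_pos (fun s _ => hk s) Finset.univ_nonempty
  have hm0 : (0 : ℝ) < m := by exact_mod_cast hm
  have hdegP : P.totalDegree ≤ m :=
    Finset.sup_le fun α hα => (hPm α hα).le
  obtain ⟨p, hp⟩ : ∃ p, p = 2 * (m : ℝ) / (m + 1) := ⟨_, rfl⟩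
  have hp0 : 0 < p := by rw [hp]; positivity
  have hp2 : p ≤ 2 := by rw [hp, div_le_iff₀ (by positivity)]; linarith
  rw [← hp]
  -- the multi-index of a tuple, and the size of its fibre
  obtain ⟨e, he⟩ : ∃ e : (∀ s, Fin (k s) → σ) → (σ →₀ ℕ),
      ∀ i, e i = ∑ s, ∑ j, Finsupp.single (i s j) 1 := ⟨_, fun _ => rfl⟩
  obtain ⟨ν, hν⟩ : ∃ ν : (σ →₀ ℕ) → ℕ, ∀ α, ν α = (Finset.univ.filter fun i => e i = α).card :=
    ⟨_, fun _ => rfl⟩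
  have hν1 : ∀ α ∈ P.support, 0 < ν α := by
    intro α hα
    obtain ⟨f, hf⟩ := exists_sum_single_eq (I := Σ s, Fin (k s)) α (by
      rw [hPm α hα, ← hkm]; simp)
    rw [hν, Finset.card_pos]
    refine ⟨fun s j => f ⟨s, j⟩, ?_⟩
    rw [Finset.mem_filter, he, ← hf, Fintype.sum_sigma]
    exact ⟨Finset.mem_univ _, rfl⟩
  obtain ⟨b, hb⟩ : ∃ b : (∀ s, Fin (k s) → σ) → ℝ,
      ∀ i, b i = (ν (e i) : ℝ) ^ (-(1 / p)) * ‖P.coeff (e i)‖ := ⟨_, fun _ => rfl⟩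
  have hb0 : ∀ i, 0 ≤ b i := fun i => by rw [hb]; positivity
  have hsum : ∑ i, b i ^ p = ∑ α ∈ P.support, ‖P.coeff α‖ ^ p := by
    have h1 : ∑ i, b i ^ p = ∑ i with e i ∈ P.support, b i ^ p := by
      refine (Finset.sum_filter_of_ne fun i _ h => ?_).symm
      rw [MvPolynomial.mem_support_iff]
      intro h0
      rw [hb, h0, norm_zero, mul_zero, Real.zero_rpow hp0.ne'] at h
      exact h rfl
    rw [h1, ← Finset.sum_fiberwise_of_maps_to (s := Finset.univ.filter fun i => e i ∈ P.support)
      (t := P.support) (g := e) (fun i hi => (Finset.mem_filter.1 hi).2)]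
    refine Finset.sum_congr rfl fun α hα => ?_
    have h2 : ∀ i ∈ (Finset.univ.filter fun i => e i ∈ P.support).filter (fun i => e i = α),
        b i ^ p = (ν α : ℝ)⁻¹ * ‖P.coeff α‖ ^ p := by
      intro i hi
      rw [hb, (Finset.mem_filter.1 hi).2, Real.mul_rpow (by positivity) (norm_nonneg _),
        ← Real.rpow_mul (by positivity)]
      congr 1
      rw [show -(1 / p) * p = -1 by field_simp, Real.rpow_neg_one]
    rw [Finset.sum_congr rfl h2, Finset.sum_const, nsmul_eq_mul]
    have h3 : (Finset.univ.filter fun i => e i ∈ P.support).filter (fun i => e i = α)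
        = Finset.univ.filter fun i => e i = α := by
      ext i
      simp only [Finset.mem_filter, Finset.mem_univ, true_and]
      exact ⟨fun h => h.2, fun h => ⟨h ▸ hα, h⟩⟩
    rw [h3, ← hν, ← mul_assoc, mul_inv_cancel₀, one_mul]
    exact_mod_cast (hν1 α hα).ne'
  have hmixed : ∀ s (y : Fin (k s) → σ), ∑ i with i s = y, b i ^ 2
      ≤ ∑ α ∈ P.support with ∑ j, Finsupp.single (y j) 1 ≤ α, ‖P.coeff α‖ ^ 2 := by
    intro s y
    have h1 : ∑ i with i s = y, b i ^ 2
        = ∑ i ∈ (Finset.univ.filter fun i => i s = y) with e i ∈ P.support, b i ^ 2 := by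
      refine (Finset.sum_filter_of_ne fun i _ h => ?_).symm
      rw [MvPolynomial.mem_support_iff]
      intro h0
      rw [hb, h0] at h
      simp at h
    rw [h1, ← Finset.sum_fiberwise_of_maps_to
      (t := P.support.filter fun α => ∑ j, Finsupp.single (y j) 1 ≤ α) (g := e) (by
        intro i hi
        simp only [Finset.mem_filter, Finset.mem_univ, true_and] at hi ⊢
        refine ⟨hi.2, ?_⟩
        rw [he, ← hi.1]
        exact Finset.single_le_sum (f := fun s => ∑ j, Finsupp.single (i s j) 1)
          (fun _ _ => zero_le) (Finset.mem_univ s))]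
    refine Finset.sum_le_sum fun α hα => ?_
    have hνα : (1 : ℝ) ≤ ν α := by exact_mod_cast hν1 α (Finset.mem_filter.1 hα).1
    have h2 : ∀ i ∈ ((Finset.univ.filter fun i => i s = y).filter
        fun i => e i ∈ P.support).filter (fun i => e i = α),
        b i ^ 2 = ((ν α : ℝ) ^ (-(1 / p))) ^ 2 * ‖P.coeff α‖ ^ 2 := by
      intro i hi
      rw [hb, (Finset.mem_filter.1 hi).2, mul_pow]
    rw [Finset.sum_congr rfl h2, Finset.sum_const, nsmul_eq_mul, ← mul_assoc]
    refine mul_le_of_le_one_left (by positivity) ?_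
    have h3 : ((((Finset.univ.filter fun i => i s = y).filter
        fun i => e i ∈ P.support).filter (fun i => e i = α)).card : ℝ) ≤ ν α := by
      rw [hν]
      norm_cast
      refine Finset.card_le_card fun i hi => ?_
      simp only [Finset.mem_filter, Finset.mem_univ, true_and] at hi ⊢
      exact hi.2
    have h4 : ((ν α : ℝ) ^ (-(1 / p))) ^ 2 ≤ (ν α : ℝ)⁻¹ := by
      rw [← Real.rpow_natCast, ← Real.rpow_mul (by positivity), ← Real.rpow_neg_one]
      refine Real.rpow_le_rpow_of_exponent_le hνα ?_
      have : 1 ≤ 1 / p * 2 := by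
        rw [div_mul_eq_mul_div, one_mul, le_div_iff₀ hp0]; linarith
      push_cast
      linarith
    calc _ ≤ (ν α : ℝ) * (ν α : ℝ)⁻¹ := by gcongr
      _ = 1 := mul_inv_cancel₀ (by positivity)
  obtain ⟨K, hK⟩ : ∃ K : J → ℝ, ∀ s, K s = ((4 : ℝ) ^ m) ^ (1 / ((k s : ℝ) + 1)) *
      (2 ^ k s * (M / t ^ k s)) ^ (2 * (k s : ℝ) / (k s + 1)) := ⟨_, fun _ => rfl⟩
  have hKpos : ∀ s, 0 < K s := fun s => by rw [hK]; positivity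
  have hF : ∀ s, ∑ y : Fin (k s) → σ, (∑ i with i s = y, b i ^ 2) ^ ((k s : ℝ) / (k s + 1))
      ≤ K s := by
    intro s
    rw [hK]
    refine le_trans (Finset.sum_le_sum fun y _ => Real.rpow_le_rpow
      (Finset.sum_nonneg fun _ _ => by positivity) (hmixed s y) (by positivity))
      (sum_rpow_coeff_mixed_le (hk s) ht hM0 P hdegP fun z hz => hP z fun v => ?_)
    have h1 : (k s : ℝ) * t ≤ κ * t := by
      have : (k s : ℝ) ≤ κ := by exact_mod_cast hκ s
      gcongr
    constructor <;> linarith [hz v]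
  have blei := sum_rpow_le_prod_of_mixed (fun s => (k s : ℝ))
    (fun s => by exact_mod_cast hk s) b hb0 K hKpos hF
  have hkmR : ∑ s, (k s : ℝ) = m := by exact_mod_cast hkm
  rw [hkmR, ← hp, hsum] at blei
  obtain ⟨D, hD⟩ : ∃ D, D = (2 / t) ^ κ * M := ⟨_, rfl⟩
  have hD0 : 0 < D := by rw [hD]; positivity
  rw [← hD]
  have hKle : ∀ s, K s ^ (((k s : ℝ) + 1) / (m + 1))
      ≤ (4 : ℝ) ^ ((m : ℝ) / (m + 1)) * D ^ (2 * (k s : ℝ) / (m + 1)) := by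
    intro s
    have hks : (0 : ℝ) < k s := by exact_mod_cast hk s
    have hle : 2 ^ k s * (M / t ^ k s) ≤ D := by
      rw [hD, show 2 ^ k s * (M / t ^ k s) = (2 / t) ^ k s * M by rw [div_pow]; ring]
      refine mul_le_mul_of_nonneg_right (pow_le_pow_right₀ ?_ (hκ s)) hM0.le
      rwa [one_le_div ht]
    rw [hK, Real.mul_rpow (by positivity) (by positivity), ← Real.rpow_mul (by positivity),
      ← Real.rpow_mul (by positivity), ← Real.rpow_natCast 4 m, ← Real.rpow_mul (by norm_num)]
    have e1 : (m : ℝ) * (1 / ((k s : ℝ) + 1) * (((k s : ℝ) + 1) / (m + 1))) = m / (m + 1) := by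
      field_simp
    have e2 : 2 * (k s : ℝ) / (k s + 1) * (((k s : ℝ) + 1) / (m + 1)) = 2 * k s / (m + 1) := by
      field_simp
    rw [e1, e2]
    gcongr
  have hfin : ∑ α ∈ P.support, ‖P.coeff α‖ ^ p ≤ (2 ^ Fintype.card J * D) ^ p := by
    refine blei.trans ((Finset.prod_le_prod (fun s _ => (Real.rpow_pos_of_pos (hKpos s) _).le)
      fun s _ => hKle s).trans (le_of_eq ?_))
    rw [Finset.prod_mul_distrib, ← Real.rpow_sum_of_pos hD0, Finset.prod_const, Finset.card_univ,
      ← Finset.sum_div, ← Finset.mul_sum, hkmR, ← hp, Real.mul_rpow (by positivity) hD0.le]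
    congr 1
    rw [← Real.rpow_natCast, ← Real.rpow_natCast, ← Real.rpow_mul (by norm_num),
      ← Real.rpow_mul (by norm_num), show (4 : ℝ) = 2 ^ (2 : ℝ) by norm_num,
      ← Real.rpow_mul (by norm_num)]
    congr 1
    rw [hp]
    ring
  have hinv : ((m : ℝ) + 1) / (2 * m) = 1 / p := by rw [hp]; field_simp
  rw [hinv]
  calc _ ≤ ((2 ^ Fintype.card J * D) ^ p) ^ (1 / p) :=
        Real.rpow_le_rpow (Finset.sum_nonneg fun _ _ => by positivity) hfin (by positivity)
    _ = _ := by
        rw [← Real.rpow_mul (by positivity), mul_one_div_cancel hp0.ne', Real.rpow_one]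

lemma abs_eval_le_sum_abs_coeff {n : ℕ} (P : MvPolynomial (Fin n) ℝ) {x : Fin n → ℝ}
    (hx : ∀ i, x i ∈ Set.Icc (-1 : ℝ) 1) :
    |MvPolynomial.eval x P| ≤ ∑ α ∈ P.support, |P.coeff α| := by
  rw [MvPolynomial.eval_eq']
  refine (Finset.abs_sum_le_sum_abs _ _).trans (Finset.sum_le_sum fun α _ => ?_)
  rw [abs_mul, Finset.abs_prod]
  refine mul_le_of_le_one_right (abs_nonneg _) (Finset.prod_le_one (fun i _ => abs_nonneg _) ?_)
  intro i _
  rw [abs_pow]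
  exact pow_le_one₀ (abs_nonneg _) (abs_le.2 (hx i))

lemma abs_eval_le_supOnBox {n : ℕ} (P : MvPolynomial (Fin n) ℝ) {x : Fin n → ℝ}
    (hx : ∀ i, x i ∈ Set.Icc (-1 : ℝ) 1) : |MvPolynomial.eval x P| ≤ supOnBox P := by
  refine le_csSup ⟨∑ α ∈ P.support, |P.coeff α|, ?_⟩ ⟨x, hx, rfl⟩
  rintro y ⟨x, hx, rfl⟩
  exact abs_eval_le_sum_abs_coeff P hx

lemma supOnBox_nonneg {n : ℕ} (P : MvPolynomial (Fin n) ℝ) : 0 ≤ supOnBox P :=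
  (abs_nonneg _).trans (abs_eval_le_supOnBox P (x := 0) (by simp))

lemma norm_cosh_le_exp {ξ : ℂ} (h : 0 ≤ ξ.re) : ‖Complex.cosh ξ‖ ≤ Real.exp ξ.re := by
  rw [Complex.cosh, norm_div]
  have h1 : ‖Complex.exp ξ + Complex.exp (-ξ)‖ ≤ Real.exp ξ.re + Real.exp ξ.re := by
    refine (norm_add_le _ _).trans ?_
    rw [Complex.norm_exp, Complex.norm_exp, Complex.neg_re]
    gcongr
    linarith
  simp only [Complex.norm_ofNat]
  linarith

lemma sinh_re_le_norm_cosh (ξ : ℂ) : Real.sinh ξ.re ≤ ‖Complex.cosh ξ‖ := by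
  rw [Complex.cosh, norm_div, Real.sinh_eq, Complex.norm_ofNat]
  have h := norm_sub_norm_le (Complex.exp ξ) (-Complex.exp (-ξ))
  rw [norm_neg, Complex.norm_exp, Complex.norm_exp, sub_neg_eq_add, Complex.neg_re] at h
  gcongr

lemma exists_cosh_eq (z : ℂ) : ∃ ξ : ℂ, 0 ≤ ξ.re ∧ Complex.cosh ξ = z := by
  obtain ⟨w, hw⟩ := Complex.cos_surjective z
  rcases le_total 0 (w * Complex.I).re with h | h
  · exact ⟨w * Complex.I, h, by rw [Complex.cosh_mul_I, hw]⟩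
  · refine ⟨-(w * Complex.I), ?_, by rw [Complex.cosh_neg, Complex.cosh_mul_I, hw]⟩
    rw [Complex.neg_re]; linarith

/-- A Bernstein–Walsh inequality for the cube, evaluated on polydiscs. -/
lemma norm_eval_map_le_of_polydisc {n : ℕ} (P : MvPolynomial (Fin n) ℝ) {d : ℕ}
    (hd : P.totalDegree ≤ d) {r : ℝ} (hr : 0 < r) (z : Fin n → ℂ) (hz : ∀ i, ‖z i‖ ≤ r) :
    ‖MvPolynomial.eval z (MvPolynomial.map (algebraMap ℝ ℂ) P)‖
      ≤ (r + √(1 + r ^ 2)) ^ d * supOnBox P := by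
  choose ξ hξ0 hξ using fun i => exists_cosh_eq (z i)
  set L := Real.arsinh r with hL
  have hL0 : 0 < L := Real.arsinh_pos_iff.2 hr
  have hξL : ∀ i, (ξ i).re ≤ L := fun i => by
    rw [hL, ← Real.sinh_le_sinh, Real.sinh_arsinh]
    exact (sinh_re_le_norm_cosh _).trans (by rw [hξ]; exact hz i)
  set s : Fin n → ℝ := fun i => (ξ i).re / L with hs
  have hs0 : ∀ i, 0 ≤ s i := fun i => div_nonneg (hξ0 i) hL0.le
  have hs1 : ∀ i, s i ≤ 1 := fun i => (div_le_one hL0).2 (hξL i)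
  let g : ℂ → Fin n → ℂ := fun ζ i => Complex.cosh (s i * ζ + (ξ i).im * Complex.I)
  let f : ℂ → ℂ := fun ζ => Complex.exp (-(d * ζ)) *
    MvPolynomial.eval (g ζ) (MvPolynomial.map (algebraMap ℝ ℂ) P)
  have hfe : ∀ ζ, f ζ = Complex.exp (-(d * ζ)) *
      ∑ α ∈ P.support, ((P.coeff α : ℝ) : ℂ) * ∏ i, g ζ i ^ α i := fun ζ => by
    simp only [f]
    rw [MvPolynomial.eval_map, MvPolynomial.eval₂_eq']
    rfl
  have hbd : ∀ ζ : ℂ, 0 ≤ ζ.re → ‖f ζ‖ ≤ ∑ α ∈ P.support, |P.coeff α| := by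
    intro ζ hζ
    rw [hfe, Finset.mul_sum]
    refine (norm_sum_le _ _).trans (Finset.sum_le_sum fun α hα => ?_)
    have hαd : (α.degree : ℝ) ≤ d := by
      exact_mod_cast (MvPolynomial.le_totalDegree hα).trans hd
    have hg : ∀ i, ‖g ζ i‖ ≤ Real.exp ζ.re := fun i => by
      have h1 : (s i * ζ + (ξ i).im * Complex.I : ℂ).re = s i * ζ.re := by simp
      refine (norm_cosh_le_exp (by rw [h1]; exact mul_nonneg (hs0 i) hζ)).trans ?_
      rw [h1]
      exact Real.exp_le_exp.2 (mul_le_of_le_one_left hζ (hs1 i))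
    have hpr : ‖∏ i, g ζ i ^ α i‖ ≤ Real.exp ζ.re ^ α.degree := by
      rw [norm_prod, Finsupp.degree_eq_sum, ← Finset.prod_pow_eq_pow_sum]
      refine Finset.prod_le_prod (fun _ _ => norm_nonneg _) fun i _ => ?_
      rw [norm_pow]
      exact pow_le_pow_left₀ (norm_nonneg _) (hg i) _
    rw [norm_mul, norm_mul, Complex.norm_real, Real.norm_eq_abs, Complex.norm_exp]
    have h2 : Real.exp (-(d * ζ) : ℂ).re * Real.exp ζ.re ^ α.degree ≤ 1 := by
      rw [← Real.exp_nat_mul, ← Real.exp_add, Real.exp_le_one_iff]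
      have : (-(d * ζ) : ℂ).re = -(d * ζ.re) := by simp
      rw [this]
      nlinarith
    calc _ ≤ Real.exp (-(d * ζ) : ℂ).re * (|P.coeff α| * Real.exp ζ.re ^ α.degree) := by gcongr
      _ = |P.coeff α| * (Real.exp (-(d * ζ) : ℂ).re * Real.exp ζ.re ^ α.degree) := by ring
      _ ≤ _ := mul_le_of_le_one_right (abs_nonneg _) h2
  have hdiff : Differentiable ℂ f := by
    have : f = fun ζ => Complex.exp (-(d * ζ)) *
      ∑ α ∈ P.support, ((P.coeff α : ℝ) : ℂ) * ∏ i, g ζ i ^ α i := funext hfe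
    rw [this]
    simp only [g]
    fun_prop
  have key := PhragmenLindelof.right_half_plane_of_bounded_on_real (f := f) (C := supOnBox P)
    (z := (L : ℂ)) hdiff.diffContOnCl ?_ ?_ ?_ (by simpa using hL0.le)
  · have hgL : g L = z := by
      funext i
      simp only [g]
      rw [← hξ i]
      congr 1
      have : (s i : ℂ) * L = (ξ i).re := by
        rw [← Complex.ofReal_mul, hs]
        simp only
        rw [div_mul_cancel₀ _ hL0.ne']
      rw [this, Complex.re_add_im]
    simp only [f] at key
    rw [hgL, norm_mul, Complex.norm_exp] at key
    have h3 : (-(d * L) : ℂ).re = -(d * L) := by simp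
    have h4 : (r + √(1 + r ^ 2)) ^ d = Real.exp (d * L) := by
      rw [Real.exp_nat_mul, Real.exp_arsinh]
    rw [h3, Real.exp_neg, inv_mul_le_iff₀ (Real.exp_pos _)] at key
    rwa [h4]
  · refine ⟨0, by norm_num, 0, ?_⟩
    refine Asymptotics.IsBigO.of_bound (∑ α ∈ P.support, |P.coeff α|) ?_
    filter_upwards [Filter.mem_inf_of_right (Filter.mem_principal_self _)] with ζ hζ
    have := hbd ζ (le_of_lt hζ)
    simpa using this
  · refine Filter.isBoundedUnder_of_eventually_le (a := ∑ α ∈ P.support, |P.coeff α|) ?_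
    filter_upwards [Filter.eventually_ge_atTop 0] with x hx
    exact hbd x (by simpa using hx)
  · intro x
    have hgx : g (x * Complex.I) = fun i => ((Real.cos (s i * x + (ξ i).im) : ℝ) : ℂ) := by
      funext i
      simp only [g]
      rw [show (s i * (x * Complex.I) + (ξ i).im * Complex.I : ℂ)
        = ((s i * x + (ξ i).im : ℝ) : ℂ) * Complex.I by push_cast; ring, Complex.cosh_mul_I,
        Complex.ofReal_cos]
    have h5 : (-(d * (x * Complex.I)) : ℂ).re = 0 := by simp
    have h6 : MvPolynomial.eval (fun i => ((Real.cos (s i * x + (ξ i).im) : ℝ) : ℂ))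
        (MvPolynomial.map (algebraMap ℝ ℂ) P)
        = ((MvPolynomial.eval (fun i => Real.cos (s i * x + (ξ i).im)) P : ℝ) : ℂ) := by
      rw [MvPolynomial.eval_map, MvPolynomial.eval₂_eq', MvPolynomial.eval_eq']
      push_cast
      rfl
    simp only [f]
    rw [norm_mul, Complex.norm_exp, h5, Real.exp_zero, one_mul, hgx, h6, Complex.norm_real]
    exact abs_eval_le_supOnBox P fun i => ⟨Real.neg_one_le_cos _, Real.cos_le_one _⟩

/-- The exponent obtained from `α` by adding a variable that brings the total degree to `d`. -/
noncomputable def homogenizedExponent {n : ℕ} (d : ℕ) (α : Fin n →₀ ℕ) : Option (Fin n) →₀ ℕ :=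
  Finsupp.equivFunOnFinite.symm fun o => o.elim (d - α.degree) α

/-- The degree `d` homogenization of a real polynomial, with complex coefficients. -/
noncomputable def homogenization {n : ℕ} (d : ℕ) (P : MvPolynomial (Fin n) ℝ) :
    MvPolynomial (Option (Fin n)) ℂ :=
  ∑ α ∈ P.support, MvPolynomial.monomial (homogenizedExponent d α) ((P.coeff α : ℝ) : ℂ)

@[simp] lemma homogenizedExponent_none {n : ℕ} (d : ℕ) (α : Fin n →₀ ℕ) :
    homogenizedExponent d α none = d - α.degree := rfl

@[simp] lemma homogenizedExponent_some {n : ℕ} (d : ℕ) (α : Fin n →₀ ℕ) (i : Fin n) :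
    homogenizedExponent d α (some i) = α i := rfl

lemma homogenizedExponent_injective {n : ℕ} (d : ℕ) :
    Function.Injective (homogenizedExponent (n := n) d) := fun α β h =>
  Finsupp.ext fun i => by simpa using DFunLike.congr_fun h (some i)

lemma degree_homogenizedExponent {n d : ℕ} {α : Fin n →₀ ℕ} (h : α.degree ≤ d) :
    (homogenizedExponent d α).degree = d := by
  rw [Finsupp.degree_eq_sum, Fintype.sum_option]
  simp only [homogenizedExponent_none, homogenizedExponent_some]
  rw [← Finsupp.degree_eq_sum]
  omega

lemma coeff_homogenization {n : ℕ} (d : ℕ) (P : MvPolynomial (Fin n) ℝ) (α : Fin n →₀ ℕ) :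
    (homogenization d P).coeff (homogenizedExponent d α) = ((P.coeff α : ℝ) : ℂ) := by
  classical
  rw [homogenization, MvPolynomial.coeff_sum]
  simp only [MvPolynomial.coeff_monomial, (homogenizedExponent_injective d).eq_iff]
  rw [Finset.sum_ite_eq']
  split_ifs with h
  · rfl
  · simp [MvPolynomial.notMem_support_iff.1 h]

lemma degree_eq_of_mem_support_homogenization {n d : ℕ} {P : MvPolynomial (Fin n) ℝ}
    (hd : P.totalDegree ≤ d) {γ : Option (Fin n) →₀ ℕ} (hγ : γ ∈ (homogenization d P).support) :
    γ.degree = d := by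
  classical
  obtain ⟨α, hα, hγα⟩ := Finset.mem_biUnion.1 (MvPolynomial.support_sum hγ)
  rw [Finset.mem_singleton.1 (MvPolynomial.support_monomial_subset hγα)]
  exact degree_homogenizedExponent ((MvPolynomial.le_totalDegree hα).trans hd)

lemma eval_homogenization {n d : ℕ} {P : MvPolynomial (Fin n) ℝ}
    (hd : P.totalDegree ≤ d) (z : Option (Fin n) → ℂ) (hz : z none ≠ 0) :
    MvPolynomial.eval z (homogenization d P) = z none ^ d *
      MvPolynomial.eval (fun i => z (some i) / z none) (MvPolynomial.map (algebraMap ℝ ℂ) P) := by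
  rw [homogenization, map_sum, MvPolynomial.eval_map, MvPolynomial.eval₂_eq', Finset.mul_sum]
  refine Finset.sum_congr rfl fun α hα => ?_
  have hα' : α.degree ≤ d := (MvPolynomial.le_totalDegree hα).trans hd
  rw [MvPolynomial.eval_monomial, Finsupp.prod_fintype _ _ (by simp), Fintype.prod_option]
  simp only [homogenizedExponent_none, homogenizedExponent_some, div_pow]
  rw [Finset.prod_div_distrib, Finset.prod_pow_eq_pow_sum, ← Finsupp.degree_eq_sum,
    ← pow_sub_mul_pow (z none) hα']
  simp only [Complex.coe_algebraMap]
  field_simp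

lemma sum_coeff_rpow_le_homogenization {n : ℕ} (d : ℕ) (P : MvPolynomial (Fin n) ℝ) (p : ℝ) :
    ∑ α ∈ P.support, |P.coeff α| ^ p
      ≤ ∑ γ ∈ (homogenization d P).support, ‖(homogenization d P).coeff γ‖ ^ p := by
  classical
  calc ∑ α ∈ P.support, |P.coeff α| ^ p
      = ∑ α ∈ P.support, ‖(homogenization d P).coeff (homogenizedExponent d α)‖ ^ p := by
        simp [coeff_homogenization]
    _ = ∑ γ ∈ P.support.image (homogenizedExponent d), ‖(homogenization d P).coeff γ‖ ^ p :=
        by rw [Finset.sum_image (homogenizedExponent_injective d).injOn]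
    _ ≤ _ := by
        refine Finset.sum_le_sum_of_subset_of_nonneg ?_ fun _ _ _ => by positivity
        intro γ hγ
        obtain ⟨α, hα, rfl⟩ := Finset.mem_image.1 hγ
        rw [MvPolynomial.mem_support_iff, coeff_homogenization]
        simpa using hα

lemma sum_coeff_rpow_le_of_blocks {n d : ℕ} (hd0 : 0 < d) (P : MvPolynomial (Fin n) ℝ)
    (hd : P.totalDegree ≤ d) {J : Type*} [Fintype J] [DecidableEq J] [Nonempty J]
    (k : J → ℕ) (hk : ∀ s, 0 < k s) (hkd : ∑ s, k s = d) {κ : ℕ} (hκ : ∀ s, k s ≤ κ)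
    {t : ℝ} (ht : 0 < t) (hκt : κ * t < 1) :
    (∑ α ∈ P.support, |P.coeff α| ^ ((2 * d : ℝ) / (d + 1))) ^ ((d + 1 : ℝ) / (2 * d))
      ≤ (2 ^ Fintype.card J * (2 / t) ^ κ * ((1 + κ * t) * ((1 + κ * t) / (1 - κ * t)
        + √(1 + ((1 + κ * t) / (1 - κ * t)) ^ 2))) ^ d) * supOnBox P := by
  set δ : ℝ := κ * t
  have hκ1 : (1 : ℝ) ≤ κ := by
    obtain ⟨s⟩ := ‹Nonempty J›
    exact_mod_cast (hk s).trans_le (hκ s)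
  have hδ0 : 0 < δ := by positivity
  have ht2 : t ≤ 2 := by
    have : 1 * t ≤ κ * t := by gcongr
    linarith
  have h1δ : 0 < 1 - δ := by linarith
  set r : ℝ := (1 + δ) / (1 - δ)
  have hr : 0 < r := by positivity
  set ρ : ℝ := r + √(1 + r ^ 2)
  have hρ : 0 < ρ := by positivity
  refine le_of_forall_pos_le_add fun ε hε => ?_
  set A : ℝ := 2 ^ Fintype.card J * (2 / t) ^ κ * ((1 + δ) * ρ) ^ d with hA
  have hA0 : 0 < A := by positivity
  have hS := supOnBox_nonneg P
  have hbound : ∀ z : Option (Fin n) → ℂ, (∀ v, 1 - δ ≤ ‖z v‖ ∧ ‖z v‖ ≤ 1 + δ) →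
      ‖MvPolynomial.eval z (homogenization d P)‖ ≤ ((1 + δ) * ρ) ^ d * (supOnBox P + ε / A) := by
    intro z hz
    have hz0 : 0 < ‖z none‖ := h1δ.trans_le (hz none).1
    rw [eval_homogenization hd z (norm_pos_iff.1 hz0), norm_mul, norm_pow]
    have h1 := norm_eval_map_le_of_polydisc P hd hr (fun i => z (some i) / z none) fun i => by
      rw [norm_div]
      exact div_le_div₀ (by positivity) (hz _).2 h1δ (hz none).1
    calc _ ≤ (1 + δ) ^ d * (ρ ^ d * supOnBox P) := by
          gcongr
          exact (hz none).2
      _ = ((1 + δ) * ρ) ^ d * supOnBox P := by rw [mul_pow]; ring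
      _ ≤ _ := by gcongr; exact le_add_of_nonneg_right (by positivity)
  have key := homogeneous_bohnenblust_hille (homogenization d P)
    (fun γ hγ => degree_eq_of_mem_support_homogenization hd hγ) k hk hkd hκ ht ht2
    (by positivity) hbound
  calc _ ≤ (∑ γ ∈ (homogenization d P).support,
        ‖(homogenization d P).coeff γ‖ ^ ((2 * d : ℝ) / (d + 1))) ^ ((d + 1 : ℝ) / (2 * d)) := by
        refine Real.rpow_le_rpow (Finset.sum_nonneg fun _ _ => by positivity) ?_ (by positivity)
        exact sum_coeff_rpow_le_homogenization d P _
    _ ≤ 2 ^ Fintype.card J * ((2 / t) ^ κ * (((1 + δ) * ρ) ^ d * (supOnBox P + ε / A))) := key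
    _ = A * (supOnBox P + ε / A) := by rw [hA]; ring
    _ = A * supOnBox P + ε := by rw [mul_add, mul_div_cancel₀ _ hA0.ne']

/-- The growth rate `(1 + δ) (r + √(1 + r²))`, `r = (1 + δ) / (1 - δ)`, of a polynomial on the
`δ`-thickened torus. -/
noncomputable def annulusRate (δ : ℝ) : ℝ :=
  (1 + δ) * ((1 + δ) / (1 - δ) + √(1 + ((1 + δ) / (1 - δ)) ^ 2))

lemma annulusRate_zero : annulusRate 0 = 1 + √2 := by
  norm_num [annulusRate]

lemma continuousAt_annulusRate_zero : ContinuousAt annulusRate 0 := by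
  unfold annulusRate
  have : ContinuousAt (fun δ : ℝ => (1 + δ) / (1 - δ)) 0 :=
    ContinuousAt.div (by fun_prop) (by fun_prop) (by norm_num)
  fun_prop

lemma one_le_annulusRate {δ : ℝ} (h0 : 0 ≤ δ) (h1 : δ < 1) : 1 ≤ annulusRate δ := by
  have hr : 1 ≤ (1 + δ) / (1 - δ) := by
    rw [le_div_iff₀ (by linarith)]
    linarith
  unfold annulusRate
  nlinarith [Real.sqrt_nonneg (1 + ((1 + δ) / (1 - δ)) ^ 2)]

lemma isDegBHConst_of_block_size {d k : ℕ} (hk : 0 < k) (hkd : k ≤ d) {t : ℝ} (ht : 0 < t)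
    (hkt : (2 * k : ℕ) * t < 1) :
    IsDegBHConst d (2 ^ (d / k) * (2 / t) ^ (2 * k) * annulusRate ((2 * k : ℕ) * t) ^ d) := by
  have hl : 0 < d / k := Nat.div_pos hkd hk
  constructor
  · have h1 : (1 : ℝ) ≤ 2 / t := by
      rw [le_div_iff₀ ht]
      have : (1 : ℝ) ≤ (2 * k : ℕ) := by exact_mod_cast (by omega : 1 ≤ 2 * k)
      nlinarith
    refine one_le_mul_of_one_le_of_one_le (one_le_mul_of_one_le_of_one_le ?_ ?_) ?_
    · exact one_le_pow₀ (by norm_num)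
    · exact one_le_pow₀ h1
    · exact one_le_pow₀ (one_le_annulusRate (by positivity) hkt)
  · intro n P hP
    have : Nonempty (Fin (d / k)) := ⟨⟨0, hl⟩⟩
    have h := sum_coeff_rpow_le_of_blocks (hk.trans_le hkd) P hP (J := Fin (d / k))
      (fun s => k + if s = ⟨0, hl⟩ then d % k else 0) (fun s => by positivity) (by
        rw [Finset.sum_add_distrib, Finset.sum_ite_eq']
        simp [Nat.div_add_mod']) (κ := 2 * k) (fun s => by
          have := Nat.mod_lt d hk
          split_ifs <;> omega) ht hkt
    rwa [Fintype.card_fin] at h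

lemma tendsto_const_mul_pow_rpow_inv {B X : ℝ} (hB : 0 < B) (hX : 0 ≤ X) :
    Filter.Tendsto (fun d : ℕ => (B * X ^ d) ^ ((d : ℝ)⁻¹)) Filter.atTop (nhds X) := by
  have h1 : Filter.Tendsto (fun d : ℕ => B ^ ((d : ℝ)⁻¹) * X) Filter.atTop (nhds X) := by
    have h2 : Filter.Tendsto (fun d : ℕ => (d : ℝ)⁻¹) Filter.atTop (nhds 0) :=
      tendsto_inv_atTop_zero.comp tendsto_natCast_atTop_atTop
    simpa using (tendsto_const_nhds.rpow h2 (Or.inl hB.ne')).mul_const X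
  refine h1.congr' ?_
  filter_upwards [Filter.eventually_ne_atTop 0] with d hd
  rw [Real.mul_rpow hB.le (pow_nonneg hX d), Real.pow_rpow_inv_natCast hX hd]

lemma eventually_bh_rpow_lt {BH : ℕ → ℝ}
    (hBH : ∀ d : ℕ, 1 ≤ d → IsLeast {C : ℝ | IsDegBHConst d C} (BH d)) {a : ℝ}
    (ha : 1 + √2 < a) : ∀ᶠ d : ℕ in Filter.atTop, (BH d) ^ ((d : ℝ)⁻¹) < a := by
  obtain ⟨k, hka, hk⟩ : ∃ k : ℕ, (2 : ℝ) ^ ((k : ℝ)⁻¹) * (1 + √2) < a ∧ 0 < k := by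
    have h2 : Filter.Tendsto (fun d : ℕ => (d : ℝ)⁻¹) Filter.atTop (nhds 0) :=
      tendsto_inv_atTop_zero.comp tendsto_natCast_atTop_atTop
    have h3 := ((tendsto_const_nhds (x := (2 : ℝ))).rpow h2 (Or.inl (by norm_num))).mul_const (1 + √2)
    rw [Real.rpow_zero, one_mul] at h3
    exact ((h3.eventually_lt_const ha).and (Filter.eventually_gt_atTop 0)).exists
  set c : ℝ := (2 : ℝ) ^ ((k : ℝ)⁻¹) with hc
  have hc1 : 1 ≤ c := Real.one_le_rpow (by norm_num) (by positivity)
  have hck : c ^ k = 2 := Real.rpow_inv_natCast_pow (by norm_num) hk.ne'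
  obtain ⟨t, ht, hkt, hta⟩ : ∃ t : ℝ, 0 < t ∧ (2 * k : ℕ) * t < 1 ∧
      c * annulusRate ((2 * k : ℕ) * t) < a := by
    have h0 : Filter.Tendsto (fun t : ℝ => ((2 * k : ℕ) : ℝ) * t) (nhdsWithin 0 (Set.Ioi 0))
        (nhds 0) := by
      have : Filter.Tendsto (fun t : ℝ => ((2 * k : ℕ) : ℝ) * t) (nhds 0) (nhds (_ * 0)) :=
        (continuous_const.mul continuous_id).tendsto 0
      rw [mul_zero] at this
      exact this.mono_left nhdsWithin_le_nhds
    have h1 := (continuousAt_annulusRate_zero.tendsto.comp h0).const_mul c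
    rw [annulusRate_zero] at h1
    obtain ⟨t, h⟩ := ((h1.eventually_lt_const hka).and
      ((h0.eventually_lt_const one_pos).and self_mem_nhdsWithin)).exists
    exact ⟨t, h.2.2, h.2.1, h.1⟩
  have hG := one_le_annulusRate (δ := (2 * k : ℕ) * t) (by positivity) hkt
  have hlim := tendsto_const_mul_pow_rpow_inv (B := (2 / t) ^ (2 * k))
    (X := c * annulusRate ((2 * k : ℕ) * t)) (by positivity) (by positivity)
  filter_upwards [hlim.eventually_lt_const hta, Filter.eventually_ge_atTop k] with d hd hkd
  refine lt_of_le_of_lt (Real.rpow_le_rpow ?_ ?_ (by positivity)) hd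
  · exact zero_le_one.trans (hBH d (by omega)).1.1
  · refine ((hBH d (by omega)).2 (isDegBHConst_of_block_size hk hkd ht hkt)).trans ?_
    have h2 : (2 : ℝ) ^ (d / k) ≤ c ^ d := by
      rw [← hck, ← pow_mul]
      exact pow_le_pow_right₀ hc1 (Nat.mul_div_le d k)
    calc _ ≤ c ^ d * (2 / t) ^ (2 * k) * annulusRate ((2 * k : ℕ) * t) ^ d := by gcongr
      _ = _ := by rw [mul_pow]; ring

/-- The Chebyshev polynomial `T_d` as a polynomial in one indexed variable. -/
noncomputable def mvChebyshev (d : ℕ) : MvPolynomial (Fin 1) ℝ :=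
  Polynomial.aeval (MvPolynomial.X 0) (Polynomial.Chebyshev.T ℝ d)

lemma totalDegree_mvChebyshev_le (d : ℕ) : (mvChebyshev d).totalDegree ≤ d := by
  rw [mvChebyshev, Polynomial.aeval_eq_sum_range]
  refine MvPolynomial.totalDegree_finsetSum_le fun i hi => ?_
  refine (MvPolynomial.totalDegree_smul_le _ _).trans ?_
  rw [MvPolynomial.totalDegree_X_pow]
  have := Finset.mem_range_succ_iff.1 hi
  rwa [Polynomial.Chebyshev.natDegree_T, Int.natAbs_natCast] at this

lemma aeval_mvChebyshev {A : Type*} [CommRing A] [Algebra ℝ A] (d : ℕ) (x : Fin 1 → A) :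
    MvPolynomial.aeval x (mvChebyshev d) = (Polynomial.Chebyshev.T A d).eval (x 0) := by
  rw [mvChebyshev, ← Polynomial.aeval_algHom_apply, MvPolynomial.aeval_X,
    Polynomial.Chebyshev.aeval_T]

lemma supOnBox_mvChebyshev_le (d : ℕ) : supOnBox (mvChebyshev d) ≤ 1 := by
  refine Real.sSup_le ?_ zero_le_one
  rintro y ⟨x, hx, rfl⟩
  rw [← MvPolynomial.coe_aeval_eq_eval, RingHom.coe_coe, aeval_mvChebyshev]
  exact Polynomial.Chebyshev.abs_eval_T_real_le_one _ (abs_le.2 (hx 0))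

lemma one_add_sqrt_two_pow_le_norm_eval_T {d : ℕ} (hd : 0 < d) :
    (1 + √2) ^ d / 4 ≤ ‖(Polynomial.Chebyshev.T ℂ d).eval Complex.I‖ := by
  set L := Real.arsinh 1
  have hI : Complex.cosh (L + (Real.pi / 2 : ℝ) * Complex.I) = Complex.I := by
    rw [Complex.cosh_add, Complex.cosh_mul_I, Complex.sinh_mul_I, ← Complex.ofReal_cos,
      ← Complex.ofReal_sin, ← Complex.ofReal_sinh, Real.cos_pi_div_two, Real.sin_pi_div_two,
      Real.sinh_arsinh]
    simp
  have hexp : Real.exp (d * L) = (1 + √2) ^ d := by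
    rw [Real.exp_nat_mul, Real.exp_arsinh]
    norm_num
  have h2 : 2 ≤ (1 + √2) ^ d := by
    have : (1 : ℝ) ≤ √2 := Real.one_le_sqrt.2 (by norm_num)
    calc (2 : ℝ) ≤ (1 + √2) ^ 1 := by linarith
      _ ≤ _ := pow_le_pow_right₀ (by linarith) hd
  rw [← hI, Polynomial.Chebyshev.T_complex_cosh]
  refine le_trans ?_ (sinh_re_le_norm_cosh _)
  have hre : (((d : ℤ) : ℂ) * (L + (Real.pi / 2 : ℝ) * Complex.I)).re = d * L := by simp
  rw [hre, Real.sinh_eq, hexp, Real.exp_neg, hexp]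
  have : ((1 + √2) ^ d)⁻¹ ≤ 2⁻¹ := inv_anti₀ (by norm_num) h2
  linarith

lemma card_support_mvPolynomial_fin_one_le {d : ℕ} {P : MvPolynomial (Fin 1) ℝ}
    (hP : P.totalDegree ≤ d) : P.support.card ≤ d + 1 := by
  rw [← Finset.card_range (d + 1)]
  refine Finset.card_le_card_of_injOn (fun α => α 0) (fun α hα => ?_) fun α _ β _ h => ?_
  · have h1 : α.degree ≤ d := (MvPolynomial.le_totalDegree hα).trans hP
    rw [Finsupp.degree_eq_sum] at h1
    simpa [Nat.lt_succ_iff] using h1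
  · refine Finsupp.ext fun i => ?_
    rw [Subsingleton.elim i 0]
    exact h

lemma norm_aeval_le_sum_abs_coeff {n : ℕ} (P : MvPolynomial (Fin n) ℝ) {z : Fin n → ℂ}
    (hz : ∀ i, ‖z i‖ ≤ 1) : ‖MvPolynomial.aeval z P‖ ≤ ∑ α ∈ P.support, |P.coeff α| := by
  rw [MvPolynomial.aeval_def, MvPolynomial.eval₂_eq']
  refine (norm_sum_le _ _).trans (Finset.sum_le_sum fun α _ => ?_)
  rw [norm_mul, norm_prod, norm_algebraMap', Real.norm_eq_abs]
  refine mul_le_of_le_one_right (abs_nonneg _) (Finset.prod_le_one (fun i _ => norm_nonneg _) ?_)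
  intro i _
  rw [norm_pow]
  exact pow_le_one₀ (norm_nonneg _) (hz i)

lemma IsDegBHConst.one_add_sqrt_two_pow_le {d : ℕ} (hd : 0 < d) {C : ℝ} (hC : IsDegBHConst d C) :
    (1 + √2) ^ d / (4 * (d + 1)) ≤ C := by
  have hdR : (0 : ℝ) < d := by exact_mod_cast hd
  set P := mvChebyshev d
  have hP : P.totalDegree ≤ d := totalDegree_mvChebyshev_le d
  set N : ℝ := (∑ α ∈ P.support, |P.coeff α| ^ ((2 * d : ℝ) / (d + 1))) ^ ((d + 1 : ℝ) / (2 * d))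
    with hN
  have hN0 : 0 ≤ N := Real.rpow_nonneg (Finset.sum_nonneg fun _ _ => by positivity) _
  have hNC : N ≤ C := by
    refine (hC.2 1 P hP).trans (mul_le_of_le_one_right ?_ (supOnBox_mvChebyshev_le d))
    exact zero_le_one.trans hC.1
  have hcoef : ∀ α ∈ P.support, |P.coeff α| ≤ N := by
    intro α hα
    have h1 := Finset.single_le_sum (f := fun α => |P.coeff α| ^ ((2 * d : ℝ) / (d + 1)))
      (fun _ _ => by positivity) hα
    have h2 := Real.rpow_le_rpow (by positivity) h1 (z := (d + 1 : ℝ) / (2 * d)) (by positivity)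
    rwa [← Real.rpow_mul (abs_nonneg _), div_mul_div_cancel₀ (by positivity),
      div_self (by positivity), Real.rpow_one] at h2
  have h3 : (1 + √2) ^ d / 4 ≤ (d + 1) * N := by
    calc (1 + √2) ^ d / 4 ≤ ‖(Polynomial.Chebyshev.T ℂ d).eval Complex.I‖ :=
          one_add_sqrt_two_pow_le_norm_eval_T hd
      _ = ‖MvPolynomial.aeval (fun _ : Fin 1 => Complex.I) P‖ := by rw [aeval_mvChebyshev]
      _ ≤ ∑ α ∈ P.support, |P.coeff α| := norm_aeval_le_sum_abs_coeff P (by simp)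
      _ ≤ P.support.card * N := by
          rw [← nsmul_eq_mul]
          exact Finset.sum_le_card_nsmul _ _ _ hcoef
      _ ≤ (d + 1) * N := by
          gcongr
          exact_mod_cast card_support_mvPolynomial_fin_one_le hP
  rw [div_le_iff₀ (by positivity)]
  nlinarith

lemma tendsto_one_add_sqrt_two_pow_div_rpow_inv :
    Filter.Tendsto (fun d : ℕ => ((1 + √2) ^ d / (4 * (d + 1))) ^ ((d : ℝ)⁻¹)) Filter.atTop
      (nhds (1 + √2)) := by
  have h1 := tendsto_const_mul_pow_rpow_inv (B := 4⁻¹) (X := 1 + √2) (by norm_num) (by positivity)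
  have h2 : Filter.Tendsto (fun d : ℕ => ((d : ℝ) + 1) ^ ((d : ℝ)⁻¹)) Filter.atTop (nhds 1) := by
    have h3 := (tendsto_rpow_div_mul_add 1 1 (-1) (by norm_num)).comp
      (tendsto_natCast_atTop_atTop.comp (Filter.tendsto_add_atTop_nat 1) :
        Filter.Tendsto (fun d : ℕ => ((d + 1 : ℕ) : ℝ)) Filter.atTop Filter.atTop)
    refine h3.congr fun d => ?_
    simp
  have h4 := h1.div h2 one_ne_zero
  rw [div_one] at h4
  refine h4.congr fun d => ?_
  rw [Pi.div_apply, ← Real.div_rpow (by positivity) (by positivity)]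
  congr 1
  field_simp

/-- If `BH d` is the smallest admissible Bohnenblust–Hille constant for real polynomials of
degree at most `d` on `[-1,1]^n`, then `limsup_{d→∞} (BH d)^{1/d} = 1 + √2`. -/
theorem limsup_bh_real_degree (BH : ℕ → ℝ)
    (hBH : ∀ d : ℕ, 1 ≤ d → IsLeast {C : ℝ | IsDegBHConst d C} (BH d)) :
    Filter.limsup (fun d : ℕ => (BH d) ^ ((d : ℝ)⁻¹)) Filter.atTop = 1 + Real.sqrt 2 := by
  refine Filter.Tendsto.limsup_eq (tendsto_order.2 ⟨fun a ha => ?_, fun a ha => ?_⟩)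
  · filter_upwards [tendsto_one_add_sqrt_two_pow_div_rpow_inv.eventually_const_lt ha,
      Filter.eventually_gt_atTop 0] with d hd hd0
    refine hd.trans_le (Real.rpow_le_rpow (by positivity) ?_ (by positivity))
    exact IsDegBHConst.one_add_sqrt_two_pow_le hd0 (hBH d hd0).1
  · exact eventually_bh_rpow_lt hBH ha
end

section
/- Let n, d ∈ ℕ and 1 ≤ k ≤ d−1, and let (a_i)_{i ∈ I(d,n)} be a family of real numbers indexed by all maps i : [d] → [n]. Then (∑_{i ∈ I(d,n)} |a_i|^{2d/(d+1)})^{(d+1)/(2d)} ≤ [∏_{S ⊆ [d], |S| = k} ( ∑_{i₁ ∈ I(S,n)} ( ∑_{i₂ ∈ I(Ŝ,n)} |a_{i₁⊕i₂}|² )^{(1/2)·(2k/(k+1))} )^{(k+1)/(2k)} ]^{1/binom(d,k)}, where Ŝ = [d] \ S and i₁⊕i₂ : [d] → [n] is the map equal to i₁ on S and to i₂ on Ŝ. -/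
open Finset

/-- The direct sum `i₁ ⊕ i₂` of `i₁ : S → [n]` and `i₂ : Ŝ → [n]` (`Ŝ = [d] \ S`): the map
`[d] → [n]` which coincides with `i₁` on `S` and with `i₂` on `Ŝ`. -/
def dirSum {d n : ℕ} (S : Finset (Fin d)) (i₁ : {x // x ∈ S} → Fin n)
    (i₂ : {x // x ∈ Sᶜ} → Fin n) : Fin d → Fin n :=
  fun k => if h : k ∈ S then i₁ ⟨k, h⟩ else i₂ ⟨k, Finset.mem_compl.mpr h⟩

open Function
open scoped NNReal

/-- Hölder's inequality for finitely many functions on a finite set. -/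
theorem NNReal.sum_prod_rpow_le {α κ : Type*} [Fintype α] (A : Finset κ) (f : κ → α → ℝ≥0)
    {w : κ → ℝ} (hw : ∑ m ∈ A, w m = 1) (hw0 : ∀ m ∈ A, 0 ≤ w m) :
    ∑ y, ∏ m ∈ A, f m y ^ w m ≤ ∏ m ∈ A, (∑ y, f m y) ^ w m := by
  let _ : MeasurableSpace α := ⊤
  have h := ENNReal.lintegral_prod_norm_pow_le (μ := MeasureTheory.Measure.count) A
    (f := fun m y => (f m y : ENNReal)) (fun m _ => Measurable.of_discrete.aemeasurable) hw hw0
  simp only [MeasureTheory.lintegral_count, tsum_fintype] at h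
  rw [← ENNReal.coe_le_coe]
  push_cast
  refine (le_of_eq ?_).trans (h.trans (le_of_eq ?_))
  · exact sum_congr rfl fun y _ => prod_congr rfl fun m hm =>
      ENNReal.coe_rpow_of_nonneg _ (hw0 m hm)
  · refine prod_congr rfl fun m hm => ?_
    rw [ENNReal.coe_rpow_of_nonneg _ (hw0 m hm)]
    push_cast
    rfl

/-- Minkowski's inequality for finitely many functions on a finite set. -/
theorem NNReal.Lp_sum_le {α β : Type*} [Fintype α] (s : Finset β) (f : α → β → ℝ≥0)
    {p : ℝ} (hp : 1 ≤ p) :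
    (∑ y, (∑ z ∈ s, f y z) ^ p) ^ (1 / p) ≤ ∑ z ∈ s, (∑ y, f y z ^ p) ^ (1 / p) := by
  classical
  have hp0 : 0 < p := by linarith
  induction s using Finset.induction_on with
  | empty => simp [hp0.ne']
  | insert b s hb ih =>
    simp only [sum_insert hb]
    exact (NNReal.Lp_add_le univ (fun y => f y b) (fun y => ∑ z ∈ s, f y z) hp).trans
      (by gcongr)

section PartialNorm

variable {ι α κ : Type*} [DecidableEq ι] [Fintype α]

/-- The `ℓ_p` norm of `f` with respect to the variables in `s`, as a function of the remaining
variables. -/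
noncomputable def partialNorm (s : Finset ι) (p : ℝ) (f : (ι → α) → ℝ≥0) (x : ι → α) : ℝ≥0 :=
  (∑ y : s → α, f (updateFinset x s y) ^ p) ^ (1 / p)

theorem partialNorm_mono (s : Finset ι) {p : ℝ} (hp : 0 < p) {f g : (ι → α) → ℝ≥0}
    (h : ∀ x, f x ≤ g x) (x : ι → α) : partialNorm s p f x ≤ partialNorm s p g x := by
  unfold partialNorm
  gcongr
  exact h _

theorem partialNorm_empty {p : ℝ} (hp : 0 < p) (f : (ι → α) → ℝ≥0) :
    partialNorm ∅ p f = f := by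
  funext x
  simp [partialNorm, ← NNReal.rpow_mul, hp.ne']

theorem partialNorm_partialNorm {s t : Finset ι} (hst : Disjoint s t) {p : ℝ} (hp : 0 < p)
    (f : (ι → α) → ℝ≥0) :
    partialNorm s p (partialNorm t p f) = partialNorm (s ∪ t) p f := by
  funext x
  simp only [partialNorm, ← NNReal.rpow_mul, one_div, inv_mul_cancel₀ hp.ne', NNReal.rpow_one,
    updateFinset_updateFinset hst]
  rw [← Fintype.sum_prod_type', ← (Equiv.piFinsetUnion (fun _ => α) hst).sum_comp]

/-- Minkowski's inequality for mixed norms. -/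
theorem partialNorm_comm_le {s t : Finset ι} (hst : Disjoint s t) {q r : ℝ} (hq : 0 < q)
    (hqr : q ≤ r) (f : (ι → α) → ℝ≥0) (x : ι → α) :
    partialNorm s r (partialNorm t q f) x ≤ partialNorm t q (partialNorm s r f) x := by
  have hr : 0 < r := hq.trans_le hqr
  have hcomm (y : s → α) (z : t → α) : updateFinset (updateFinset x t z) s y =
      updateFinset (updateFinset x s y) t z := by
    funext i
    have h : i ∈ s → i ∉ t := fun hi => Finset.disjoint_left.mp hst hi
    grind [updateFinset]
  have h := NNReal.Lp_sum_le univ (fun (y : s → α) (z : t → α) =>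
    f (updateFinset (updateFinset x s y) t z) ^ q) (p := r / q) ((one_le_div hq).2 hqr)
  have h' := NNReal.rpow_le_rpow h (z := 1 / q) (by positivity)
  have e₁ : 1 / (r / q) * (1 / q) = 1 / r := by field_simp
  have e₂ : q * (r / q) = r := by field_simp
  have e₃ : 1 / q * r = r / q := by field_simp
  have e₄ : 1 / r * q = 1 / (r / q) := by field_simp
  simpa only [partialNorm, ← NNReal.rpow_mul, e₁, e₂, e₃, e₄, hcomm] using h'

/-- Hölder's inequality for partial norms. -/
theorem partialNorm_prod_le (s : Finset ι) (A : Finset κ) {θ P : κ → ℝ} {p : ℝ} (hp : 0 < p)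
    (hθ : ∀ m ∈ A, 0 ≤ θ m) (hP : ∀ m ∈ A, 0 < P m) (hsum : ∑ m ∈ A, θ m / P m = 1 / p)
    (f : κ → (ι → α) → ℝ≥0) (x : ι → α) :
    partialNorm s p (fun z => ∏ m ∈ A, f m z ^ θ m) x ≤
      ∏ m ∈ A, partialNorm s (P m) (f m) x ^ θ m := by
  have h := NNReal.sum_prod_rpow_le A (fun m (y : s → α) => f m (updateFinset x s y) ^ P m)
    (w := fun m => θ m / P m * p) (by rw [← sum_mul, hsum]; field_simp)
    (fun m hm => mul_nonneg (div_nonneg (hθ m hm) (hP m hm).le) hp.le)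
  have h' := NNReal.rpow_le_rpow h (z := 1 / p) (by positivity)
  refine (le_of_eq ?_).trans (h'.trans (le_of_eq ?_))
  · unfold partialNorm
    congr 1
    refine sum_congr rfl fun y _ => ?_
    rw [← NNReal.finsetProd_rpow]
    refine prod_congr rfl fun m hm => ?_
    have := (hP m hm).ne'
    rw [← NNReal.rpow_mul, ← NNReal.rpow_mul]
    congr 1
    field_simp
  · rw [← NNReal.finsetProd_rpow]
    refine prod_congr rfl fun m hm => ?_
    have := (hP m hm).ne'
    rw [partialNorm, ← NNReal.rpow_mul, ← NNReal.rpow_mul]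
    congr 1
    field_simp

/-- Interpolation of mixed norms with exponent `q` on the variables in `S m` and exponent `r ≥ q`
on the remaining ones. -/
theorem partialNorm_le_prod_mixed (A : Finset κ) (S : κ → Finset ι) {θ : κ → ℝ} {p q r : ℝ}
    (hp : 0 < p) (hq : 0 < q) (hqr : q ≤ r) (hθ : ∀ m ∈ A, 0 ≤ θ m) (hθ1 : ∑ m ∈ A, θ m = 1)
    (hsum : ∀ j, ∑ m ∈ A, θ m / (if j ∈ S m then q else r) = 1 / p)
    (f : (ι → α) → ℝ≥0) (u : Finset ι) (x : ι → α) :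
    partialNorm u p f x ≤
      ∏ m ∈ A, partialNorm (u ∩ S m) q (partialNorm (u \ S m) r f) x ^ θ m := by
  have hr : 0 < r := hq.trans_le hqr
  induction u using Finset.induction_on generalizing x with
  | empty =>
    simp only [empty_inter, empty_sdiff, partialNorm_empty hp, partialNorm_empty hq,
      partialNorm_empty hr]
    by_cases hx : f x = 0
    · simp [hx]
    · have hx' : (0 : ℝ) < f x := NNReal.coe_pos.2 (pos_iff_ne_zero.2 hx)
      refine le_of_eq (NNReal.coe_injective ?_)
      push_cast
      rw [← Real.rpow_sum_of_pos hx', hθ1, Real.rpow_one]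
  | insert j u hj ih =>
    rw [insert_eq, ← partialNorm_partialNorm (by simpa using hj) hp]
    refine (partialNorm_mono _ hp ih x).trans
      ((partialNorm_prod_le _ A hp hθ (fun m _ => ?_) (hsum j) _ x).trans ?_)
    · split_ifs <;> assumption
    · refine prod_le_prod' fun m hm => NNReal.rpow_le_rpow ?_ (hθ m hm)
      split_ifs with hjm
      · rw [partialNorm_partialNorm (by simp [hj]) hq]
        have e₁ : ({j} ∪ u) ∩ S m = {j} ∪ u ∩ S m := by grind
        have e₂ : ({j} ∪ u) \ S m = u \ S m := by grind
        rw [e₁, e₂]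
      · have e₁ : ({j} ∪ u) ∩ S m = u ∩ S m := by grind
        have e₂ : ({j} ∪ u) \ S m = {j} ∪ u \ S m := by grind
        rw [e₁, e₂, ← partialNorm_partialNorm (by simp [hj]) hr]
        exact partialNorm_comm_le (by simp [hj]) hq hqr _ x

end PartialNorm

theorem card_filter_card_eq_notMem {ι : Type*} [Fintype ι] [DecidableEq ι] (k : ℕ) (j : ι) :
    #{S : Finset ι | S.card = k ∧ j ∉ S} = (Fintype.card ι - 1).choose k := by
  have h : ({S : Finset ι | S.card = k ∧ j ∉ S} : Finset (Finset ι)) =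
      powersetCard k (univ.erase j) := by
    ext S
    simp [mem_powersetCard, subset_erase, and_comm]
  rw [h, card_powersetCard, card_erase_of_mem (mem_univ j), card_univ]

/-- The exponents in Blei's inequality average out in every coordinate. -/
theorem sum_inv_choose_div_exponent {d k : ℕ} (hk : 1 ≤ k) (hkd : k ≤ d) (j : Fin d) :
    ∑ S : Finset (Fin d) with S.card = k,
      (d.choose k : ℝ)⁻¹ / (if j ∈ S then (2 * k / (k + 1) : ℝ) else 2) =
      1 / (2 * d / (d + 1)) := by
  have hC : (0 : ℝ) < d.choose k := by exact_mod_cast Nat.choose_pos hkd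
  have hk0 : (0 : ℝ) < k := by exact_mod_cast hk
  have hd0 : (0 : ℝ) < d := by exact_mod_cast hk.trans hkd
  have hnot := card_filter_card_eq_notMem k j
  have htot : #{S : Finset (Fin d) | S.card = k} = d.choose k := by simp
  have hsplit := card_filter_add_card_filter_not (s := {S : Finset (Fin d) | S.card = k})
    (fun S => j ∈ S)
  rw [filter_filter, filter_filter, hnot, htot, Fintype.card_fin] at hsplit
  have hchoose : (d - 1).choose k * d = d.choose k * (d - k) := by
    obtain ⟨e, rfl⟩ : ∃ e, d = e + 1 := ⟨d - 1, by omega⟩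
    exact Nat.choose_mul_succ_eq e k
  rw [Fintype.card_fin] at hnot
  simp only [apply_ite (fun t : ℝ => (d.choose k : ℝ)⁻¹ / t)]
  rw [sum_ite, sum_const, sum_const, filter_filter, filter_filter, hnot, nsmul_eq_mul,
    nsmul_eq_mul]
  have h₁ : (#{S : Finset (Fin d) | S.card = k ∧ j ∈ S} : ℝ) + (d - 1).choose k =
      d.choose k := by exact_mod_cast hsplit
  have h₂ : ((d - 1).choose k : ℝ) * d = d.choose k * (d - k) := by
    rw [← Nat.cast_sub hkd]
    exact_mod_cast hchoose
  rw [← eq_sub_iff_add_eq] at h₁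
  rw [h₁, eq_div_of_mul_eq hd0.ne' h₂]
  field_simp
  ring

theorem updateFinset_updateFinset_compl {d n : ℕ} (S : Finset (Fin d)) (x : Fin d → Fin n)
    (y : S → Fin n) (z : (Sᶜ : Finset (Fin d)) → Fin n) :
    updateFinset (updateFinset x S y) Sᶜ z = dirSum S y z := by
  funext i
  by_cases hi : i ∈ S <;> simp [updateFinset, dirSum, hi]

/-- Blei's inequality for matrices `(a_i)_{i ∈ I(d,n)}` indexed by maps `i : [d] → [n]`. -/
theorem blei_inequality (n d k : ℕ) (hk : 1 ≤ k) (hkd : k ≤ d - 1)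
    (a : (Fin d → Fin n) → ℝ) :
    (∑ i : Fin d → Fin n, |a i| ^ ((2 * d : ℝ) / (d + 1))) ^ ((d + 1 : ℝ) / (2 * d))
      ≤ (∏ S ∈ Finset.univ.filter (fun S : Finset (Fin d) => S.card = k),
          (∑ i₁ : {x // x ∈ S} → Fin n,
            (∑ i₂ : {x // x ∈ Sᶜ} → Fin n, (a (dirSum S i₁ i₂)) ^ 2)
              ^ ((1 / 2 : ℝ) * (2 * k / (k + 1))))
            ^ ((k + 1 : ℝ) / (2 * k))) ^ ((d.choose k : ℝ)⁻¹) := by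
  have hkd' : k ≤ d := hkd.trans (Nat.sub_le d 1)
  have hk0 : (0 : ℝ) < k := by exact_mod_cast hk
  have hd0 : (0 : ℝ) < d := by exact_mod_cast hk.trans hkd'
  have hC : (d.choose k : ℝ) ≠ 0 := by exact_mod_cast (Nat.choose_pos hkd').ne'
  rcases isEmpty_or_nonempty (Fin d → Fin n) with _ | ⟨⟨x⟩⟩
  · rw [univ_eq_empty, sum_empty, Real.zero_rpow (by positivity)]
    positivity
  have h := partialNorm_le_prod_mixed (p := 2 * d / (d + 1)) (q := 2 * k / (k + 1)) (r := 2)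
    {S : Finset (Fin d) | S.card = k} id (θ := fun _ => (d.choose k : ℝ)⁻¹)
    (by positivity) (by positivity) (by rw [div_le_iff₀ (by positivity)]; linarith)
    (fun _ _ => by positivity)
    (by
      have := Fintype.card_finset_len (α := Fin d) k
      rw [Fintype.card_subtype, Fintype.card_fin] at this
      rw [sum_const, this, nsmul_eq_mul, mul_inv_cancel₀ hC])
    (sum_inv_choose_div_exponent hk hkd') (fun i => Real.nnabs (a i)) univ x
  rw [NNReal.finsetProd_rpow] at h
  have huniv : partialNorm univ (2 * d / (d + 1) : ℝ) (fun i => Real.nnabs (a i)) x =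
      (∑ i, Real.nnabs (a i) ^ (2 * d / (d + 1) : ℝ)) ^ ((d + 1 : ℝ) / (2 * d)) := by
    rw [partialNorm, one_div_div]
    congr 1
    refine Fintype.sum_equiv ((Equiv.subtypeUnivEquiv mem_univ).arrowCongr (Equiv.refl _)) _ _
      fun y => ?_
    congr 3
    funext i
    simp [updateFinset]
  simp only [id, univ_inter, ← compl_eq_univ_sdiff, huniv] at h
  simp only [partialNorm, updateFinset_updateFinset_compl, one_div_div, ← NNReal.rpow_mul] at h
  rw [← NNReal.coe_le_coe] at h
  push_cast at h
  simpa using h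
end

section
/- Let 1 < p ≤ 2, and let f : {-1,1}^n → ℝ be a function of degree at most d. Then ‖f‖₂ ≤ (1/√(p−1))^d · ‖f‖_p. -/
open Finset

/-- The Walsh character `χ_S(x) = ∏_{k ∈ S} x_k` on the Boolean cube `{-1,1}^n`,
where a point of the cube is encoded as `x : Fin n → Bool` (`true ↦ 1`, `false ↦ -1`). -/
noncomputable def walsh {n : ℕ} (S : Finset (Fin n)) (x : Fin n → Bool) : ℝ :=
  ∏ k ∈ S, (if x k then (1 : ℝ) else -1)

/-- The Fourier–Walsh coefficient `f̂(S) = 2^{-n} ∑_x f(x) χ_S(x)`. -/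
noncomputable def walshCoeff {n : ℕ} (f : (Fin n → Bool) → ℝ) (S : Finset (Fin n)) : ℝ :=
  (∑ x : Fin n → Bool, f x * walsh S x) / 2 ^ n

/-- The `L_p`-norm `‖f‖_p = (2^{-n} ∑_x |f(x)|^p)^{1/p}` on the Boolean cube. -/
noncomputable def pNorm {n : ℕ} (p : ℝ) (f : (Fin n → Bool) → ℝ) : ℝ :=
  ((∑ x : Fin n → Bool, |f x| ^ p) / 2 ^ n) ^ (1 / p)

/-- For `1 < p ≤ 2` the even part of
`(1 + y) ^ p` dominates its second order Taylor polynomial. -/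
theorem two_add_le_one_add_rpow_add_one_sub_rpow {p y : ℝ} (hp₁ : 1 < p) (hp₂ : p ≤ 2)
    (hy₀ : 0 ≤ y) (hy₁ : y ≤ 1) :
    2 + p * (p - 1) * y ^ 2 ≤ (1 + y) ^ p + (1 - y) ^ p := by
  have hderiv : ∀ t ∈ Set.Ico (0 : ℝ) 1,
      0 ≤ (1 + t) ^ (p - 1) - (1 - t) ^ (p - 1) - 2 * (p - 1) * t := by
    have hmono : MonotoneOn
        (fun t : ℝ => (1 + t) ^ (p - 1) - (1 - t) ^ (p - 1) - 2 * (p - 1) * t)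
        (Set.Ico 0 1) := by
      refine monotoneOn_of_hasDerivWithinAt_nonneg
        (f' := fun t => (p - 1) * ((1 + t) ^ (p - 2) + (1 - t) ^ (p - 2) - 2))
        (convex_Ico 0 1) ?_ ?_ ?_
      · refine ContinuousOn.sub (ContinuousOn.sub ?_ ?_) (by fun_prop)
        · exact ContinuousOn.rpow_const (by fun_prop) fun t _ => Or.inr (by linarith)
        · exact ContinuousOn.rpow_const (by fun_prop) fun t _ => Or.inr (by linarith)
      · intro t ht
        rw [interior_Ico] at ht
        refine HasDerivAt.hasDerivWithinAt ?_
        have h₁ : HasDerivAt (fun t : ℝ => (1 + t) ^ (p - 1)) _ t :=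
          ((hasDerivAt_id' t).const_add 1).rpow_const (Or.inl (by linarith [ht.1]))
        have h₂ : HasDerivAt (fun t : ℝ => (1 - t) ^ (p - 1)) _ t :=
          ((hasDerivAt_id' t).const_sub 1).rpow_const (Or.inl (by linarith [ht.2]))
        refine ((h₁.sub h₂).sub ((hasDerivAt_id' t).const_mul (2 * (p - 1)))).congr_deriv ?_
        rw [show p - 1 - 1 = p - 2 by ring]
        ring
      · intro t ht
        rw [interior_Ico] at ht
        obtain ⟨ht₀, ht₁⟩ := ht
        have hu : 0 < (1 + t) ^ (p - 2) := Real.rpow_pos_of_pos (by linarith) _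
        have hv : 0 < (1 - t) ^ (p - 2) := Real.rpow_pos_of_pos (by linarith) _
        have huv : 1 ≤ (1 + t) ^ (p - 2) * (1 - t) ^ (p - 2) := by
          rw [← Real.mul_rpow (by linarith) (by linarith)]
          exact Real.one_le_rpow_of_pos_of_le_one_of_nonpos (by nlinarith) (by nlinarith)
            (by linarith)
        have : 2 ≤ (1 + t) ^ (p - 2) + (1 - t) ^ (p - 2) := by
          nlinarith [sq_nonneg ((1 + t) ^ (p - 2) - (1 - t) ^ (p - 2))]
        exact mul_nonneg (by linarith) (by linarith)
    intro t ht
    simpa using hmono (Set.left_mem_Ico.2 one_pos) ht ht.1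
  have hmono : MonotoneOn
      (fun t : ℝ => (1 + t) ^ p + (1 - t) ^ p - p * (p - 1) * t ^ 2) (Set.Icc 0 1) := by
    refine monotoneOn_of_hasDerivWithinAt_nonneg
      (f' := fun t => p * ((1 + t) ^ (p - 1) - (1 - t) ^ (p - 1) - 2 * (p - 1) * t))
      (convex_Icc 0 1) ?_ ?_ ?_
    · refine ContinuousOn.sub (ContinuousOn.add ?_ ?_) (by fun_prop)
      · exact ContinuousOn.rpow_const (by fun_prop) fun t _ => Or.inr (by linarith)
      · exact ContinuousOn.rpow_const (by fun_prop) fun t _ => Or.inr (by linarith)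
    · intro t ht
      rw [interior_Icc] at ht
      refine HasDerivAt.hasDerivWithinAt ?_
      have h₁ : HasDerivAt (fun t : ℝ => (1 + t) ^ p) _ t :=
        ((hasDerivAt_id' t).const_add 1).rpow_const (Or.inl (by linarith [ht.1]))
      have h₂ : HasDerivAt (fun t : ℝ => (1 - t) ^ p) _ t :=
        ((hasDerivAt_id' t).const_sub 1).rpow_const (Or.inl (by linarith [ht.2]))
      have h₃ : HasDerivAt (fun t : ℝ => p * (p - 1) * t ^ 2) _ t :=
        (hasDerivAt_pow 2 t).const_mul (p * (p - 1))
      refine ((h₁.add h₂).sub h₃).congr_deriv ?_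
      push_cast
      ring
    · intro t ht
      rw [interior_Icc] at ht
      exact mul_nonneg (by linarith) (hderiv t ⟨ht.1.le, ht.2⟩)
  have := hmono (Set.left_mem_Icc.2 zero_le_one) ⟨hy₀, hy₁⟩ hy₀
  norm_num at this
  linarith

/-- The two-point hypercontractive inequality, for ordered nonnegative arguments. -/
theorem two_point_inequality_of_le {p a b : ℝ} (hp₁ : 1 < p) (hp₂ : p ≤ 2)
    (hb : 0 ≤ b) (hba : b ≤ a) :
    (a ^ 2 + (p - 1) * b ^ 2) ^ (p / 2) ≤ ((a + b) ^ p + (a - b) ^ p) / 2 := by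
  rcases (hb.trans hba).eq_or_lt with rfl | ha
  · obtain rfl : b = 0 := le_antisymm hba hb
    simp [Real.zero_rpow (show p ≠ 0 by linarith), Real.zero_rpow (show p / 2 ≠ 0 by linarith)]
  obtain ⟨y, rfl⟩ : ∃ y, b = a * y := ⟨b / a, by field_simp⟩
  have hy₀ : 0 ≤ y := nonneg_of_mul_nonneg_right hb ha
  have hy₁ : y ≤ 1 := by nlinarith
  have hbern : (1 + (p - 1) * y ^ 2) ^ (p / 2) ≤ 1 + p / 2 * ((p - 1) * y ^ 2) :=
    rpow_one_add_le_one_add_mul_self (by nlinarith [sq_nonneg y]) (by linarith) (by linarith)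
  have htaylor := two_add_le_one_add_rpow_add_one_sub_rpow hp₁ hp₂ hy₀ hy₁
  have hsq : (a ^ 2) ^ (p / 2) = a ^ p := by
    rw [← Real.rpow_natCast, ← Real.rpow_mul ha.le]
    congr 1
    push_cast
    ring
  rw [show a ^ 2 + (p - 1) * (a * y) ^ 2 = a ^ 2 * (1 + (p - 1) * y ^ 2) by ring,
    show a + a * y = a * (1 + y) by ring, show a - a * y = a * (1 - y) by ring,
    Real.mul_rpow (by positivity) (by nlinarith [sq_nonneg y]), hsq,
    Real.mul_rpow ha.le (by linarith), Real.mul_rpow ha.le (by linarith), ← mul_add,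
    mul_div_assoc]
  exact mul_le_mul_of_nonneg_left (by linarith) (Real.rpow_nonneg ha.le _)

/-- The two-point hypercontractive inequality of Bonami. -/
theorem two_point_inequality {p : ℝ} (hp₁ : 1 < p) (hp₂ : p ≤ 2) (a b : ℝ) :
    (a ^ 2 + (p - 1) * b ^ 2) ^ (p / 2) ≤ (|a + b| ^ p + |a - b| ^ p) / 2 := by
  wlog ha : 0 ≤ a generalizing a b
  · have := this (-a) (-b) (by linarith)
    rwa [neg_sq, neg_sq, ← neg_add, abs_neg, ← neg_sub', abs_neg] at this
  wlog hb : 0 ≤ b generalizing b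
  · have := this (-b) (by linarith)
    rwa [neg_sq, ← sub_eq_add_neg, sub_neg_eq_add, add_comm (|a - b| ^ p)] at this
  rcases le_total b a with hba | hab
  · rw [abs_of_nonneg (by linarith), abs_of_nonneg (by linarith)]
    exact two_point_inequality_of_le hp₁ hp₂ hb hba
  · rw [abs_sub_comm, abs_of_nonneg (by linarith), abs_of_nonneg (by linarith), add_comm a b]
    refine le_trans (Real.rpow_le_rpow ?_ ?_ (by linarith))
      (two_point_inequality_of_le hp₁ hp₂ ha hab)
    · have : 0 ≤ p - 1 := by linarith
      positivity
    · nlinarith [mul_nonneg (sub_nonneg.2 hp₂) (sub_nonneg.2 (pow_le_pow_left₀ ha hab 2))]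

/-- Minkowski's inequality for finite sums of vectors in the two-dimensional `ℓ^q` space. -/
theorem rpow_sum_add_rpow_sum_le {ι : Type*} (s : Finset ι) {q : ℝ} (hq : 1 ≤ q)
    {u v : ι → ℝ} (hu : ∀ i, 0 ≤ u i) (hv : ∀ i, 0 ≤ v i) :
    ((∑ i ∈ s, u i) ^ q + (∑ i ∈ s, v i) ^ q) ^ (1 / q) ≤
      ∑ i ∈ s, (u i ^ q + v i ^ q) ^ (1 / q) := by
  classical
  induction s using Finset.induction_on with
  | empty =>
    simp [Real.zero_rpow (show q ≠ 0 by linarith), Real.zero_rpow (show q⁻¹ ≠ 0 by positivity)]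
  | insert i s hi ih =>
    rw [Finset.sum_insert hi, Finset.sum_insert hi, Finset.sum_insert hi]
    have h := Real.Lp_add_le_of_nonneg (s := Finset.univ) (f := ![u i, v i])
      (g := ![∑ i ∈ s, u i, ∑ i ∈ s, v i]) hq
      (by simp [Fin.forall_fin_two, hu, hv])
      (by simp [Fin.forall_fin_two, Finset.sum_nonneg, hu, hv])
    simp only [Fin.sum_univ_two, Matrix.cons_val_zero, Matrix.cons_val_one] at h
    exact h.trans (add_le_add_right ih _)

/-- The sum of the squares of the Walsh coefficients of `f`, weighted by `c ^ |S|`. -/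
noncomputable def walshEnergy {n : ℕ} (c : ℝ) (f : (Fin n → Bool) → ℝ) : ℝ :=
  ∑ S : Finset (Fin n), c ^ #S * walshCoeff f S ^ 2

theorem sum_pow_card_mul_walsh_mul_walsh {n : ℕ} (c : ℝ) (x y : Fin n → Bool) :
    ∑ S : Finset (Fin n), c ^ #S * (walsh S x * walsh S y) =
      ∏ k, (1 + c * ((if x k then 1 else -1) * (if y k then 1 else -1))) := by
  simp only [walsh, Finset.prod_one_add, Finset.powerset_univ, Finset.prod_mul_distrib,
    Finset.prod_const]

theorem walshEnergy_eq_kernel {n : ℕ} (c : ℝ) (f : (Fin n → Bool) → ℝ) :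
    walshEnergy c f = (∑ x, ∑ y, f x * f y *
      ∏ k, (1 + c * ((if x k then 1 else -1) * (if y k then 1 else -1)))) / 4 ^ n := by
  simp only [← sum_pow_card_mul_walsh_mul_walsh, Finset.mul_sum]
  simp only [Finset.sum_comm (t := (Finset.univ : Finset (Finset (Fin n)))), walshEnergy,
    walshCoeff]
  rw [Finset.sum_div]
  refine Finset.sum_congr rfl fun S _ => ?_
  rw [div_pow, sq (∑ x, f x * walsh S x), Finset.sum_mul_sum, ← pow_mul, mul_comm n 2, pow_mul,
    ← mul_div_assoc, Finset.mul_sum]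
  norm_num only
  congr 1
  refine Finset.sum_congr rfl fun x _ => ?_
  rw [Finset.mul_sum]
  refine Finset.sum_congr rfl fun y _ => ?_
  ring

theorem sum_cube_succ {n : ℕ} (F : (Fin (n + 1) → Bool) → ℝ) :
    ∑ x, F x = ∑ x : Fin n → Bool, (F (Fin.cons true x) + F (Fin.cons false x)) := by
  rw [← (Fin.consEquiv fun _ => Bool).sum_comp, Fintype.sum_prod_type, Fintype.sum_bool,
    Finset.sum_add_distrib]
  rfl

theorem walshEnergy_succ {n : ℕ} (c : ℝ) (f : (Fin (n + 1) → Bool) → ℝ) :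
    walshEnergy c f =
      walshEnergy c (fun x => (f (Fin.cons true x) + f (Fin.cons false x)) / 2) +
      c * walshEnergy c (fun x => (f (Fin.cons true x) - f (Fin.cons false x)) / 2) := by
  simp only [walshEnergy_eq_kernel, sum_cube_succ, Fin.prod_univ_succ, Fin.cons_zero,
    Fin.cons_succ, ← mul_div_assoc, ← add_div, pow_succ, Finset.mul_sum,
    ← Finset.sum_add_distrib]
  rw [← div_div, div_right_comm]
  congr 1
  rw [Finset.sum_div]
  refine Finset.sum_congr rfl fun x _ => ?_
  rw [Finset.sum_div]
  refine Finset.sum_congr rfl fun y _ => ?_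
  simp only [if_true, Bool.false_eq_true, if_false]
  ring

/-- Parseval's identity. -/
theorem walshEnergy_one {n : ℕ} (f : (Fin n → Bool) → ℝ) :
    walshEnergy 1 f = (∑ x, f x ^ 2) / 2 ^ n := by
  have hkernel : ∀ x y : Fin n → Bool,
      ∏ k, (1 + 1 * ((if x k then 1 else -1) * (if y k then 1 else -1)) : ℝ) =
        if x = y then 2 ^ n else 0 := by
    intro x y
    split_ifs with hxy
    · subst hxy
      rw [Finset.prod_congr rfl (g := fun _ => (2 : ℝ))]
      · simp
      · intro k _
        cases x k <;> norm_num
    · obtain ⟨k, hk⟩ := Function.ne_iff.1 hxy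
      refine Finset.prod_eq_zero (Finset.mem_univ k) ?_
      revert hk
      cases x k <;> cases y k <;> simp
  rw [walshEnergy_eq_kernel]
  simp only [hkernel]
  simp only [mul_ite, mul_zero, Finset.sum_ite_eq, Finset.mem_univ, if_true]
  rw [← Finset.sum_mul, show (4 : ℝ) = 2 * 2 by norm_num, mul_pow,
    mul_div_mul_right _ _ (by positivity)]
  simp only [sq]

/-- The Bonami–Beckner inequality: the noise operator with parameter `√(p - 1)` is a contraction
from `L_p` to `L_2`. -/
theorem walshEnergy_le {p : ℝ} (hp₁ : 1 < p) (hp₂ : p ≤ 2) :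
    ∀ {n : ℕ} (f : (Fin n → Bool) → ℝ),
      walshEnergy (p - 1) f ≤ ((∑ x, |f x| ^ p) / 2 ^ n) ^ (2 / p)
  | 0, f => by
    have hp : p ≠ 0 := by linarith
    rw [walshEnergy_eq_kernel]
    simp only [Finset.univ_unique, Finset.sum_singleton, Finset.univ_eq_empty, Finset.prod_empty,
      pow_zero, div_one, mul_one]
    rw [← Real.rpow_mul (abs_nonneg _), mul_div_cancel₀ _ hp, Real.rpow_two, sq_abs, sq]
  | n + 1, f => by
    set g : (Fin n → Bool) → ℝ := fun x => (f (Fin.cons true x) + f (Fin.cons false x)) / 2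
      with hg
    set h : (Fin n → Bool) → ℝ := fun x => (f (Fin.cons true x) - f (Fin.cons false x)) / 2
      with hh
    have hp₀ : 0 < p := by linarith
    have hc : 0 ≤ p - 1 := by linarith
    set r := Real.sqrt (p - 1)
    have hr₀ : 0 ≤ r := Real.sqrt_nonneg _
    have hrr : r ^ 2 = p - 1 := Real.sq_sqrt hc
    have hq : 1 ≤ 2 / p := by rwa [le_div_iff₀ hp₀, one_mul]
    have hpow : ∀ t : ℝ, (|t| ^ p) ^ (2 / p) = t ^ 2 := fun t => by
      rw [← Real.rpow_mul (abs_nonneg _), mul_div_cancel₀ _ hp₀.ne', Real.rpow_two, sq_abs]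
    have hscale : (p - 1) * ((∑ x, |h x| ^ p) / 2 ^ n) ^ (2 / p) =
        ((∑ x, |r * h x| ^ p) / 2 ^ n) ^ (2 / p) := by
      simp only [abs_mul, Real.mul_rpow (abs_nonneg r) (abs_nonneg _)]
      rw [← Finset.mul_sum, mul_div_assoc, Real.mul_rpow (by positivity) (by positivity), hpow,
        hrr]
    have hmink := rpow_sum_add_rpow_sum_le Finset.univ hq
      (u := fun x => |g x| ^ p) (v := fun x => |r * h x| ^ p)
      (fun _ => by positivity) (fun _ => by positivity)
    have hpoint : ∑ x, ((|g x| ^ p) ^ (2 / p) + (|r * h x| ^ p) ^ (2 / p)) ^ (1 / (2 / p)) ≤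
        (∑ x, |f x| ^ p) / 2 := by
      rw [sum_cube_succ, Finset.sum_div]
      refine Finset.sum_le_sum fun x _ => ?_
      rw [hpow, hpow, mul_pow, hrr, one_div_div]
      refine (two_point_inequality hp₁ hp₂ (g x) (h x)).trans_eq ?_
      rw [hg, hh]
      ring_nf
    have hA : 0 ≤ ∑ x, |g x| ^ p := Finset.sum_nonneg fun _ _ => by positivity
    have hB : 0 ≤ ∑ x, |r * h x| ^ p := Finset.sum_nonneg fun _ _ => by positivity
    have hsum := Real.rpow_le_rpow (by positivity) (hmink.trans hpoint)
      (show 0 ≤ 2 / p by positivity)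
    rw [← Real.rpow_mul (by positivity), one_div_mul_cancel (by positivity), Real.rpow_one] at hsum
    calc walshEnergy (p - 1) f = walshEnergy (p - 1) g + (p - 1) * walshEnergy (p - 1) h :=
          walshEnergy_succ _ f
      _ ≤ ((∑ x, |g x| ^ p) / 2 ^ n) ^ (2 / p) +
          (p - 1) * ((∑ x, |h x| ^ p) / 2 ^ n) ^ (2 / p) :=
          add_le_add (walshEnergy_le hp₁ hp₂ g)
            (mul_le_mul_of_nonneg_left (walshEnergy_le hp₁ hp₂ h) hc)
      _ = ((∑ x, |g x| ^ p) ^ (2 / p) + (∑ x, |r * h x| ^ p) ^ (2 / p)) /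
          (2 ^ n) ^ (2 / p) := by
          rw [hscale, Real.div_rpow hA (by positivity), Real.div_rpow hB (by positivity), add_div]
      _ ≤ ((∑ x, |f x| ^ p) / 2) ^ (2 / p) / (2 ^ n) ^ (2 / p) := by gcongr
      _ = ((∑ x, |f x| ^ p) / 2 ^ (n + 1)) ^ (2 / p) := by
          rw [← Real.div_rpow (by positivity) (by positivity), div_div, pow_succ']

/-- A function of degree at most `d` loses at most a factor `c ^ d` in its weighted energy. -/
theorem pow_mul_walshEnergy_one_le {n d : ℕ} {c : ℝ} (hc₀ : 0 ≤ c) (hc₁ : c ≤ 1)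
    (f : (Fin n → Bool) → ℝ) (hf : ∀ S : Finset (Fin n), d < #S → walshCoeff f S = 0) :
    c ^ d * walshEnergy 1 f ≤ walshEnergy c f := by
  rw [walshEnergy, walshEnergy, Finset.mul_sum]
  refine Finset.sum_le_sum fun S _ => ?_
  rcases lt_or_ge d #S with hS | hS
  · simp [hf S hS]
  · rw [one_pow, one_mul]
    exact mul_le_mul_of_nonneg_right (pow_le_pow_of_le_one hc₀ hc₁ hS) (sq_nonneg _)

/-- Hypercontractive estimate: `‖f‖₂ ≤ (1/√(p-1))^d ‖f‖_p` for `f` of degree at most `d`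
and `1 < p ≤ 2`. -/
theorem hypercontractivity_two_p {n d : ℕ} {p : ℝ} (hp₁ : 1 < p) (hp₂ : p ≤ 2)
    (f : (Fin n → Bool) → ℝ)
    (hf : ∀ S : Finset (Fin n), d < S.card → walshCoeff f S = 0) :
    pNorm 2 f ≤ (1 / Real.sqrt (p - 1)) ^ d * pNorm p f := by
  have hc : 0 < p - 1 := by linarith
  have henergy := (pow_mul_walshEnergy_one_le hc.le (by linarith) f hf).trans
    (walshEnergy_le hp₁ hp₂ f)
  set A := (∑ x, |f x| ^ p) / 2 ^ n with hA
  have hA₀ : 0 ≤ A := div_nonneg (Finset.sum_nonneg fun _ _ => by positivity) (by positivity)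
  have hleft : pNorm 2 f = Real.sqrt (walshEnergy 1 f) := by
    rw [pNorm, walshEnergy_one, Real.sqrt_eq_rpow]
    simp only [Real.rpow_two, sq_abs]
  have hright : pNorm p f ^ 2 = A ^ (2 / p) := by
    rw [pNorm, ← hA, ← Real.rpow_two, ← Real.rpow_mul hA₀]
    congr 1
    ring
  have hnonneg : 0 ≤ pNorm p f := Real.rpow_nonneg hA₀ _
  rw [hleft]
  refine Real.sqrt_le_iff.2 ⟨by positivity, ?_⟩
  rw [mul_pow, hright, ← pow_mul, mul_comm d 2, pow_mul, div_pow, Real.sq_sqrt hc.le, one_pow,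
    one_div, inv_pow, ← div_eq_inv_mul, le_div_iff₀' (by positivity)]
  exact henergy
end

section
/- Let f : {-1,1}^n → ℝ be a function of degree at most d. Then ‖f‖₂ ≤ e^d · ‖f‖₁. -/
open Finset

/-- The mean of a function on the Boolean cube. -/
noncomputable def cubeMean {n : ℕ} (f : (Fin n → Bool) → ℝ) : ℝ :=
  (∑ x, f x) / 2 ^ n

/-- The point of the cube obtained by flipping the `i`-th coordinate. -/
def flipCoord {n : ℕ} (i : Fin n) (x : Fin n → Bool) : Fin n → Bool :=
  Function.update x i (!x i)

lemma flipCoord_involutive {n : ℕ} (i : Fin n) : Function.Involutive (flipCoord i) := by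
  intro x
  simp [flipCoord]

lemma flipCoord_zero_cons {n : ℕ} (b : Bool) (x : Fin n → Bool) :
    flipCoord 0 (Fin.cons b x : Fin (n + 1) → Bool) = Fin.cons (!b) x := by
  simp [flipCoord, Fin.update_cons_zero]

lemma flipCoord_succ_cons {n : ℕ} (i : Fin n) (b : Bool) (x : Fin n → Bool) :
    flipCoord i.succ (Fin.cons b x : Fin (n + 1) → Bool) = Fin.cons b (flipCoord i x) := by
  simp [flipCoord, Fin.cons_update]

lemma cubeMean_nonneg {n : ℕ} {f : (Fin n → Bool) → ℝ} (hf : ∀ x, 0 ≤ f x) :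
    0 ≤ cubeMean f :=
  div_nonneg (sum_nonneg fun x _ => hf x) (by positivity)

lemma cubeMean_mono {n : ℕ} {f g : (Fin n → Bool) → ℝ} (h : ∀ x, f x ≤ g x) :
    cubeMean f ≤ cubeMean g := by
  unfold cubeMean
  gcongr with x
  exact h x

lemma cubeMean_add {n : ℕ} (f g : (Fin n → Bool) → ℝ) :
    cubeMean (fun x => f x + g x) = cubeMean f + cubeMean g := by
  simp [cubeMean, sum_add_distrib, add_div]

lemma cubeMean_const_mul {n : ℕ} (c : ℝ) (f : (Fin n → Bool) → ℝ) :
    cubeMean (fun x => c * f x) = c * cubeMean f := by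
  simp [cubeMean, ← mul_sum, mul_div_assoc]

lemma cubeMean_succ {n : ℕ} (f : (Fin (n + 1) → Bool) → ℝ) :
    cubeMean f = (cubeMean (fun x => f (Fin.cons true x)) +
      cubeMean (fun x => f (Fin.cons false x))) / 2 := by
  have h : ∑ x, f x = ∑ x, f (Fin.cons true x) + ∑ x, f (Fin.cons false x) := by
    rw [← (Fin.consEquiv (fun _ : Fin (n + 1) => Bool)).sum_comp, Fintype.sum_prod_type]
    simp [Fin.consEquiv]
  unfold cubeMean
  rw [h, pow_succ]
  field_simp

/-- Minkowski's inequality on the cube, squared. -/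
lemma sq_sqrt_cubeMean_sub_le {n : ℕ} (f g : (Fin n → Bool) → ℝ) :
    (√(cubeMean fun x => f x ^ 2) - √(cubeMean fun x => g x ^ 2)) ^ 2 ≤
      cubeMean fun x => (f x - g x) ^ 2 := by
  have hA : 0 ≤ cubeMean fun x => f x ^ 2 := cubeMean_nonneg fun x => sq_nonneg _
  have hB : 0 ≤ cubeMean fun x => g x ^ 2 := cubeMean_nonneg fun x => sq_nonneg _
  have hexp : cubeMean (fun x => (f x - g x) ^ 2) =
      cubeMean (fun x => f x ^ 2) + cubeMean (fun x => g x ^ 2)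
        + (-2) * cubeMean (fun x => f x * g x) := by
    rw [← cubeMean_const_mul, ← cubeMean_add, ← cubeMean_add]
    congr 1
    ext x
    ring
  have hcs : cubeMean (fun x => f x * g x) ≤
      √(cubeMean fun x => f x ^ 2) * √(cubeMean fun x => g x ^ 2) := by
    rw [← Real.sqrt_mul hA]
    apply Real.le_sqrt_of_sq_le
    have := sum_mul_sq_le_sq_mul_sq univ f g
    unfold cubeMean
    rw [div_pow, div_mul_div_comm, ← sq]
    gcongr
  rw [hexp, sub_sq, Real.sq_sqrt hA, Real.sq_sqrt hB]
  linarith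

lemma one_add_mul_log_sub_le {t : ℝ} (h0 : 0 ≤ t) (h1 : t ≤ 1) :
    (1 + t) * Real.log (1 + t) - (1 - t) * Real.log (1 - t) - 2 * t ≤ 0 := by
  have hanti : AntitoneOn (fun t : ℝ =>
      (1 + t) * Real.log (1 + t) - (1 - t) * Real.log (1 - t) - 2 * t) (Set.Icc 0 1) := by
    refine antitoneOn_of_hasDerivWithinAt_nonpos (convex_Icc 0 1)
      (f' := fun t => Real.log (1 + t) + Real.log (1 - t)) ?_ ?_ ?_
    · have cp : Continuous fun t : ℝ => 1 + t := by fun_prop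
      have cm : Continuous fun t : ℝ => 1 - t := by fun_prop
      have hp := Real.continuous_mul_log.comp cp
      have hm := Real.continuous_mul_log.comp cm
      exact ((hp.sub hm).sub (continuous_const.mul continuous_id)).continuousOn
    · intro t ht
      rw [interior_Icc] at ht
      have hp : HasDerivAt (fun t : ℝ => 1 + t) 1 t := (hasDerivAt_id t).const_add 1
      have hm : HasDerivAt (fun t : ℝ => 1 - t) (-1) t := (hasDerivAt_id t).const_sub 1
      have hp0 : 1 + t ≠ 0 := by linarith [ht.1]
      have hm0 : 1 - t ≠ 0 := by linarith [ht.2]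
      have := ((hp.mul (hp.log hp0)).sub (hm.mul (hm.log hm0))).sub
        ((hasDerivAt_id t).const_mul 2)
      refine (this.congr_deriv ?_).hasDerivWithinAt
      field_simp
      ring
    · intro t ht
      rw [interior_Icc] at ht
      have ha := Real.log_le_sub_one_of_pos (show 0 < 1 + t by linarith [ht.1])
      have hb := Real.log_le_sub_one_of_pos (show 0 < 1 - t by linarith [ht.2])
      linarith
  simpa using hanti (Set.left_mem_Icc.2 zero_le_one) ⟨h0, h1⟩ h0

lemma one_add_sq_mul_log_le {t : ℝ} (h0 : 0 ≤ t) (h1 : t ≤ 1) :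
    (1 + t) ^ 2 * Real.log (1 + t) + (1 - t) ^ 2 * Real.log (1 - t) ≤ 3 * t ^ 2 := by
  have hanti : AntitoneOn (fun t : ℝ =>
      (1 + t) * ((1 + t) * Real.log (1 + t)) + (1 - t) * ((1 - t) * Real.log (1 - t))
        - 3 * t ^ 2) (Set.Icc 0 1) := by
    refine antitoneOn_of_hasDerivWithinAt_nonpos (convex_Icc 0 1)
      (f' := fun t => 2 * ((1 + t) * Real.log (1 + t) - (1 - t) * Real.log (1 - t) - 2 * t))
      ?_ ?_ ?_
    · have cp : Continuous fun t : ℝ => 1 + t := by fun_prop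
      have cm : Continuous fun t : ℝ => 1 - t := by fun_prop
      have hp := cp.mul (Real.continuous_mul_log.comp cp)
      have hm := cm.mul (Real.continuous_mul_log.comp cm)
      have hq : Continuous fun t : ℝ => 3 * t ^ 2 := by fun_prop
      exact ((hp.add hm).sub hq).continuousOn
    · intro t ht
      rw [interior_Icc] at ht
      have hp : HasDerivAt (fun t : ℝ => 1 + t) 1 t := (hasDerivAt_id t).const_add 1
      have hm : HasDerivAt (fun t : ℝ => 1 - t) (-1) t := (hasDerivAt_id t).const_sub 1
      have hp0 : 1 + t ≠ 0 := by linarith [ht.1]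
      have hm0 : 1 - t ≠ 0 := by linarith [ht.2]
      have := ((hp.mul (hp.mul (hp.log hp0))).add (hm.mul (hm.mul (hm.log hm0)))).sub
        ((hasDerivAt_pow 2 t).const_mul 3)
      refine (this.congr_deriv ?_).hasDerivWithinAt
      simp only [Pi.mul_apply]
      field_simp
      norm_num
      ring
    · intro t ht
      rw [interior_Icc] at ht
      have := one_add_mul_log_sub_le ht.1.le ht.2.le
      linarith
  have := hanti (Set.left_mem_Icc.2 zero_le_one) ⟨h0, h1⟩ h0
  norm_num at this
  linarith

/-- The logarithmic Sobolev inequality on the two-point space. -/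
lemma two_point_log_sobolev {a b : ℝ} (ha : 0 ≤ a) (hb : 0 ≤ b) :
    (a ^ 2 * Real.log (a ^ 2) + b ^ 2 * Real.log (b ^ 2)) / 2
      - (a ^ 2 + b ^ 2) / 2 * Real.log ((a ^ 2 + b ^ 2) / 2) ≤ (a - b) ^ 2 / 2 := by
  wlog hab : b ≤ a generalizing a b
  · have := this hb ha (le_of_not_ge hab)
    rw [add_comm (b ^ 2), add_comm (b ^ 2 * _)] at this
    linarith [sq_nonneg (a - b), sub_sq_comm a b]
  rcases ha.eq_or_lt with rfl | ha
  · simp [le_antisymm hab hb]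
  obtain ⟨s, t, hs, ht0, ht1, rfl, rfl⟩ : ∃ s t : ℝ, 0 < s ∧ 0 ≤ t ∧ t ≤ 1 ∧
      s * (1 + t) = a ∧ s * (1 - t) = b := by
    have hpos : 0 < a + b := by linarith
    refine ⟨(a + b) / 2, (a - b) / (a + b), by linarith,
      div_nonneg (by linarith) hpos.le, (div_le_one hpos).2 (by linarith), ?_, ?_⟩ <;>
    · field_simp
      ring
  have hm : ((s * (1 + t)) ^ 2 + (s * (1 - t)) ^ 2) / 2 = s ^ 2 * (1 + t ^ 2) := by ring
  have hlog : ∀ u : ℝ, (s * u) ^ 2 * Real.log ((s * u) ^ 2) =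
      s ^ 2 * u ^ 2 * (2 * Real.log s) + 2 * s ^ 2 * (u ^ 2 * Real.log u) := by
    intro u
    rcases eq_or_ne u 0 with rfl | hu
    · simp
    · rw [Real.log_pow, Real.log_mul hs.ne' hu]
      push_cast
      ring
  have hlm : Real.log (s ^ 2 * (1 + t ^ 2)) = 2 * Real.log s + Real.log (1 + t ^ 2) := by
    rw [Real.log_mul (by positivity) (by positivity), Real.log_pow]
    norm_cast
  have hl : t ^ 2 ≤ (1 + t ^ 2) * Real.log (1 + t ^ 2) := by
    have hp : 0 < 1 + t ^ 2 := by positivity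
    have := mul_le_mul_of_nonneg_left (Real.one_sub_inv_le_log_of_pos hp) hp.le
    rw [mul_sub, mul_inv_cancel₀ hp.ne'] at this
    linarith
  have hk := one_add_sq_mul_log_le ht0 ht1
  rw [hm, hlog, hlog, hlm]
  have := mul_le_mul_of_nonneg_left (add_le_add hk hl) (sq_nonneg s)
  linarith

/-- The logarithmic Sobolev inequality on the Boolean cube. -/
lemma cube_log_sobolev {n : ℕ} (f : (Fin n → Bool) → ℝ) :
    cubeMean (fun x => f x ^ 2 * Real.log (f x ^ 2))
      - cubeMean (fun x => f x ^ 2) * Real.log (cubeMean fun x => f x ^ 2)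
      ≤ (∑ i, cubeMean fun x => (f x - f (flipCoord i x)) ^ 2) / 2 := by
  induction n with
  | zero => simp [cubeMean]
  | succ n ih =>
    have ht := ih fun x => f (Fin.cons true x)
    have hf := ih fun x => f (Fin.cons false x)
    set A := cubeMean fun x => f (Fin.cons true x) ^ 2 with hA
    set B := cubeMean fun x => f (Fin.cons false x) ^ 2 with hB
    have hA0 : 0 ≤ A := cubeMean_nonneg fun x => sq_nonneg _
    have hB0 : 0 ≤ B := cubeMean_nonneg fun x => sq_nonneg _
    have h2 := two_point_log_sobolev (Real.sqrt_nonneg A) (Real.sqrt_nonneg B)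
    have h3 := sq_sqrt_cubeMean_sub_le (fun x => f (Fin.cons true x))
      fun x => f (Fin.cons false x)
    rw [Real.sq_sqrt hA0, Real.sq_sqrt hB0] at h2
    simp only [← hA, ← hB] at h3
    have h0 : cubeMean (fun x => (f x - f (flipCoord 0 x)) ^ 2) =
        cubeMean fun x => (f (Fin.cons true x) - f (Fin.cons false x)) ^ 2 := by
      rw [cubeMean_succ]
      simp only [flipCoord_zero_cons, Bool.not_true, Bool.not_false]
      simp only [sub_sq_comm (f (Fin.cons false _)), add_self_div_two]
    rw [Fin.sum_univ_succ, h0, cubeMean_succ, cubeMean_succ (fun x => f x ^ 2)]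
    simp only [cubeMean_succ (fun x => (f x - f (flipCoord (Fin.succ _) x)) ^ 2),
      flipCoord_succ_cons, ← sum_div, sum_add_distrib, ← hA, ← hB]
    linarith

/-- Completeness of the Walsh characters. -/
lemma sum_walsh_mul_walsh {n : ℕ} (x y : Fin n → Bool) :
    ∑ S, walsh S x * walsh S y = if x = y then (2 : ℝ) ^ n else 0 := by
  have h := prod_one_add (univ : Finset (Fin n))
    (f := fun k => (if x k then (1 : ℝ) else -1) * (if y k then (1 : ℝ) else -1))
  rw [powerset_univ] at h
  simp only [walsh, ← prod_mul_distrib]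
  rw [← h]
  split_ifs with hxy
  · subst hxy
    have : ∀ k, (1 : ℝ) + (if x k then (1 : ℝ) else -1) * (if x k then (1 : ℝ) else -1) = 2 := by
      intro k
      split_ifs <;> norm_num
    simp only [this, prod_const, card_univ, Fintype.card_fin]
  · obtain ⟨k, hk⟩ := Function.ne_iff.1 hxy
    refine prod_eq_zero (mem_univ k) ?_
    cases hx : x k <;> cases hy : y k <;> simp_all

/-- Parseval's identity. -/
lemma sum_walshCoeff_sq {n : ℕ} (f : (Fin n → Bool) → ℝ) :
    ∑ S, walshCoeff f S ^ 2 = cubeMean fun x => f x ^ 2 := by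
  have h : ∑ S, (∑ x, f x * walsh S x) ^ 2 = 2 ^ n * ∑ x, f x ^ 2 := by
    calc ∑ S, (∑ x, f x * walsh S x) ^ 2
        = ∑ S, ∑ x, ∑ y, f x * f y * (walsh S x * walsh S y) := by
          refine sum_congr rfl fun S _ => ?_
          rw [sq, sum_mul_sum]
          exact sum_congr rfl fun x _ => sum_congr rfl fun y _ => by ring
      _ = ∑ x, ∑ y, f x * f y * ∑ S, walsh S x * walsh S y := by
          rw [sum_comm]
          refine sum_congr rfl fun x _ => ?_
          rw [sum_comm]
          exact sum_congr rfl fun y _ => by rw [mul_sum]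
      _ = 2 ^ n * ∑ x, f x ^ 2 := by
          simp only [sum_walsh_mul_walsh, mul_ite, mul_zero, sum_ite_eq, mem_univ, if_true,
            mul_sum]
          exact sum_congr rfl fun x _ => by ring
  simp only [walshCoeff, cubeMean, div_pow, ← sum_div, h]
  field_simp

lemma walsh_flipCoord {n : ℕ} (S : Finset (Fin n)) (i : Fin n) (x : Fin n → Bool) :
    walsh S (flipCoord i x) = if i ∈ S then -walsh S x else walsh S x := by
  have hne : ∀ T : Finset (Fin n), i ∉ T → walsh T (flipCoord i x) = walsh T x := by
    intro T hT
    refine prod_congr rfl fun k hk => ?_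
    have : k ≠ i := fun h => hT (h ▸ hk)
    simp [flipCoord, this]
  split_ifs with hi
  · have h := hne (S.erase i) (notMem_erase i S)
    unfold walsh at h ⊢
    rw [← mul_prod_erase S _ hi, ← mul_prod_erase S (fun k => if x k then (1 : ℝ) else -1) hi, h]
    cases hx : x i <;> simp [flipCoord, hx]
  · exact hne S hi

lemma walshCoeff_sub_flipCoord {n : ℕ} (f : (Fin n → Bool) → ℝ) (i : Fin n)
    (S : Finset (Fin n)) :
    walshCoeff (fun x => f x - f (flipCoord i x)) S =
      if i ∈ S then 2 * walshCoeff f S else 0 := by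
  have h : ∑ x, f (flipCoord i x) * walsh S x = ∑ x, f x * walsh S (flipCoord i x) := by
    rw [← Equiv.sum_comp (flipCoord_involutive i).toPerm]
    simp [(flipCoord_involutive i) _]
  simp only [walshCoeff, sub_mul, sum_sub_distrib, h, walsh_flipCoord]
  split_ifs
  · simp only [mul_neg, sum_neg_distrib]
    ring
  · simp

/-- The total influence of a function of degree at most `d` is at most `d` times its
second moment. -/
lemma sum_cubeMean_sub_flipCoord_sq_le {n d : ℕ} (f : (Fin n → Bool) → ℝ)
    (hf : ∀ S : Finset (Fin n), d < S.card → walshCoeff f S = 0) :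
    ∑ i, cubeMean (fun x => (f x - f (flipCoord i x)) ^ 2) ≤
      4 * d * cubeMean fun x => f x ^ 2 := by
  simp only [← sum_walshCoeff_sq, walshCoeff_sub_flipCoord]
  rw [sum_comm, mul_sum]
  refine sum_le_sum fun S _ => ?_
  have h : ∑ i, (if i ∈ S then 2 * walshCoeff f S else 0) ^ 2 =
      4 * S.card * walshCoeff f S ^ 2 := by
    simp only [ite_pow, sum_ite_mem, univ_inter, sum_const, nsmul_eq_mul, ne_eq,
      OfNat.ofNat_ne_zero, not_false_eq_true, zero_pow]
    ring
  rw [h]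
  by_cases hS : d < S.card
  · simp [hf S hS]
  · have : (S.card : ℝ) ≤ d := by exact_mod_cast not_lt.1 hS
    gcongr

/-- Gibbs-type lower bound for the first moment through the entropy of `f ^ 2`. -/
lemma neg_half_cubeMean_sq_mul_log_le {n : ℕ} (f : (Fin n → Bool) → ℝ) {c : ℝ} (hc : 0 < c) :
    -(cubeMean (fun x => f x ^ 2 * Real.log (f x ^ 2)) / 2)
      - cubeMean (fun x => f x ^ 2) * Real.log c
      ≤ c⁻¹ * cubeMean (fun x => |f x|) - cubeMean fun x => f x ^ 2 := by
  have key : ∀ x, (-1 / 2) * (f x ^ 2 * Real.log (f x ^ 2)) + (1 - Real.log c) * f x ^ 2 ≤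
      c⁻¹ * |f x| := by
    intro x
    rcases eq_or_ne (f x) 0 with h0 | h0
    · simp [h0]
    have hp : 0 < |f x| := abs_pos.2 h0
    have h := Real.one_sub_inv_le_log_of_pos (mul_pos hc hp)
    rw [Real.log_mul hc.ne' hp.ne', mul_inv] at h
    rw [← sq_abs (f x), Real.log_pow]
    have := mul_le_mul_of_nonneg_left h (sq_nonneg |f x|)
    have hinv : |f x| ^ 2 * (1 - c⁻¹ * |f x|⁻¹) = |f x| ^ 2 - c⁻¹ * |f x| := by
      field_simp
    rw [hinv] at this
    push_cast
    linarith
  have := cubeMean_mono key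
  rw [cubeMean_add, cubeMean_const_mul, cubeMean_const_mul, cubeMean_const_mul] at this
  linarith

/-- Hypercontractive estimate: `‖f‖₂ ≤ e^d ‖f‖₁` for `f` of degree at most `d`. -/
theorem hypercontractivity_two_one {n d : ℕ} (f : (Fin n → Bool) → ℝ)
    (hf : ∀ S : Finset (Fin n), d < S.card → walshCoeff f S = 0) :
    pNorm 2 f ≤ Real.exp d * pNorm 1 f := by
  have h2 : pNorm 2 f = √(cubeMean fun x => f x ^ 2) := by
    simp [pNorm, cubeMean, Real.sqrt_eq_rpow]
  have h1 : pNorm 1 f = cubeMean fun x => |f x| := by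
    simp [pNorm, cubeMean]
  rw [h1, h2]
  have hls := cube_log_sobolev f
  have hinf := sum_cubeMean_sub_flipCoord_sq_le f hf
  have hgibbs := fun c => neg_half_cubeMean_sq_mul_log_le f (c := c)
  have hB0 : 0 ≤ cubeMean fun x => |f x| := cubeMean_nonneg fun x => abs_nonneg _
  have hzero : cubeMean (fun x => |f x|) = 0 → cubeMean (fun x => f x ^ 2) = 0 := by
    intro h
    simp only [cubeMean, div_eq_zero_iff, pow_eq_zero_iff', OfNat.ofNat_ne_zero, false_and,
      or_false] at h ⊢
    rw [sum_eq_zero_iff_of_nonneg fun x _ => abs_nonneg _] at h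
    exact sum_eq_zero fun x hx => by simpa using h x hx
  have hA0 : 0 ≤ cubeMean fun x => f x ^ 2 := cubeMean_nonneg fun x => sq_nonneg _
  set A := cubeMean fun x => f x ^ 2
  set B := cubeMean fun x => |f x|
  rcases hA0.eq_or_lt with hA | hA
  · rw [← hA, Real.sqrt_zero]
    positivity
  have hB : 0 < B := hB0.lt_of_ne' fun h => hA.ne' (hzero h)
  have hg := hgibbs (B / A) (by positivity)
  rw [Real.log_div hB.ne' hA.ne', inv_div, div_mul_cancel₀ _ hB.ne'] at hg
  have hmul : A * (Real.log A / 2) ≤ A * (d + Real.log B) := by linarith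
  have hlog := le_of_mul_le_mul_left hmul hA
  rw [← Real.log_sqrt hA.le] at hlog
  rw [← Real.log_le_log_iff (Real.sqrt_pos.2 hA) (by positivity),
    Real.log_mul (Real.exp_ne_zero _) hB.ne', Real.log_exp]
  exact hlog
end
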